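/- Let H ∈ (0,1) with H ≠ 1/2, let W^H be a fractional Brownian motion with Hurst parameter H, and let X_t := x₀ + W^H_t + ∫₀ᵗ ξ_s ds for t ∈ [0,1], where ξ is progressively measurable with respect to the natural filtration of W^H and satisfies: if H < 1/2, there is a finite random variable C with |ξ_t(ω)| ≤ C(ω) for a.e. t and P-a.s. ω; if H > 1/2, for P-a.s. ω the map t ↦ ξ_t(ω) is Hölder continuous with some exponent α(ω) > 2H − 1. Let g ∈ C²(ℝ) satisfy ∫₀¹ (g'(X_s))² ds > 0 P-a.s., and set Y_t := ∫₀ᵗ g(X_s) ds. Fix m ∈ ℕ, α₀ > 0 and α₁,…,α_m ≥ 0. Then, with probability one, |𝓡^s_n(Y) − H| = O(√n · 2^{−(H/2 ∧ 1/4)n}) as n → ∞. -/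

import Mathlib

open MeasureTheory ProbabilityTheory Filter

/-- Approximated Faber–Schauder coefficient `ϑ^f_{n,k}`. -/
noncomputable def vartheta (f : ℝ → ℝ) (n k : ℕ) : ℝ :=
  (2 : ℝ) ^ ((3 * (n : ℝ)) / 2 + 3) *
    (f ((4 * k) / 2 ^ (n + 2)) - 2 * f ((4 * k + 1) / 2 ^ (n + 2))
      + 2 * f ((4 * k + 3) / 2 ^ (n + 2)) - f ((4 * k + 4) / 2 ^ (n + 2)))

/-- The estimator `𝓡̂_n(f) = 1 - (1/n) log₂ √(Σ_k (ϑ^f_{n,k})²)`. -/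
noncomputable def Rhat (n : ℕ) (f : ℝ → ℝ) : ℝ :=
  1 - (1 / (n : ℝ)) * Real.logb 2 (Real.sqrt (∑ k ∈ Finset.range (2 ^ n), (vartheta f n k) ^ 2))

/-- Covariance function of fractional Brownian motion with Hurst parameter `H`. -/
noncomputable def fbmCov (H s t : ℝ) : ℝ :=
  (s ^ (2 * H) + t ^ (2 * H) - |s - t| ^ (2 * H)) / 2

/-- `W` is a fractional Brownian motion with Hurst parameter `H` on `[0,1]`:
it has a.s. continuous paths and centered Gaussian finite-dimensional distributions
with covariance `fbmCov H`. -/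
def IsFBM {Ω : Type*} [MeasurableSpace Ω] (P : Measure Ω) (H : ℝ) (W : ℝ → Ω → ℝ) : Prop :=
  (∀ t, Measurable (W t)) ∧
  (∀ᵐ ω ∂P, ContinuousOn (fun t => W t ω) (Set.Icc 0 1)) ∧
  ∀ (n : ℕ) (t c : Fin n → ℝ), (∀ i, t i ∈ Set.Icc (0 : ℝ) 1) →
    Measure.map (fun ω => ∑ i, c i * W (t i) ω) P =
      gaussianReal 0 (Real.toNNReal (∑ i, ∑ j, c i * c j * fbmCov H (t i) (t j)))

section

open Set Topology

/-! ### Riemann sums -/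

lemma abs_riemann_sum_sub_integral_le {f : ℝ → ℝ} {N : ℕ} (hN : 0 < N) {ε : ℝ}
    (hf : IntervalIntegrable f volume 0 1)
    (hε : ∀ m < N, ∀ x ∈ Icc ((m : ℝ) / N) ((m + 1 : ℝ) / N), |f x - f ((m : ℝ) / N)| ≤ ε) :
    |1 / (N : ℝ) * ∑ m ∈ Finset.range N, f ((m : ℝ) / N) - ∫ x in (0 : ℝ)..1, f x| ≤ ε := by
  have hN' : (0 : ℝ) < N := by exact_mod_cast hN
  have hsub : ∀ m < N, Set.uIcc ((m : ℝ) / N) ((m + 1 : ℝ) / N) ⊆ Set.uIcc 0 1 := by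
    intro m hm
    rw [uIcc_of_le (by gcongr; linarith), uIcc_of_le zero_le_one]
    apply Icc_subset_Icc (by positivity)
    rw [div_le_one hN']
    exact_mod_cast hm
  have hint : ∀ m < N, IntervalIntegrable f volume ((m : ℝ) / N) ((m + 1 : ℝ) / N) :=
    fun m hm => hf.mono_set (hsub m hm)
  have hsum : ∫ x in (0 : ℝ)..1, f x =
      ∑ m ∈ Finset.range N, ∫ x in ((m : ℝ) / N)..((m + 1 : ℝ) / N), f x := by
    have h := intervalIntegral.sum_integral_adjacent_intervals (μ := volume) (f := f)
      (a := fun m : ℕ => (m : ℝ) / N) (n := N) (fun k hk => by simpa using hint k hk)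
    simp only [Nat.cast_zero, zero_div, div_self hN'.ne'] at h
    rw [← h]
    simp
  rw [hsum, Finset.mul_sum, ← Finset.sum_sub_distrib]
  calc _ ≤ ∑ m ∈ Finset.range N, |1 / (N : ℝ) * f ((m : ℝ) / N) -
        ∫ x in ((m : ℝ) / N)..((m + 1 : ℝ) / N), f x| := Finset.abs_sum_le_sum_abs _ _
    _ ≤ ∑ m ∈ Finset.range N, ε / N := by
        apply Finset.sum_le_sum
        intro m hm
        rw [Finset.mem_range] at hm
        have hlen : ((m + 1 : ℝ) / N) - (m : ℝ) / N = 1 / N := by ring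
        have h1 : 1 / (N : ℝ) * f ((m : ℝ) / N) - ∫ x in ((m : ℝ) / N)..((m + 1 : ℝ) / N), f x
            = ∫ x in ((m : ℝ) / N)..((m + 1 : ℝ) / N), (f ((m : ℝ) / N) - f x) := by
          rw [intervalIntegral.integral_sub (by simp) (hint m hm)]
          simp [hlen]
        rw [h1]
        have := intervalIntegral.norm_integral_le_of_norm_le_const
          (f := fun x => f ((m : ℝ) / N) - f x) (a := (m : ℝ) / N) (b := (m + 1 : ℝ) / N) (C := ε)
          (fun x hx => by
            rw [uIoc_of_le (by gcongr; linarith)] at hx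
            rw [norm_sub_rev]
            exact hε m hm x ⟨hx.1.le, hx.2⟩)
        rw [hlen, abs_of_pos (by positivity)] at this
        rw [← Real.norm_eq_abs, div_eq_mul_one_div ε]
        exact this
    _ = ε := by
        rw [Finset.sum_const, Finset.card_range, nsmul_eq_mul]
        field_simp

lemma tendsto_riemann_sum {f : ℝ → ℝ} (hf : ContinuousOn f (Icc 0 1)) :
    Tendsto (fun N : ℕ => 1 / (N : ℝ) * ∑ m ∈ Finset.range N, f ((m : ℝ) / N)) atTop
      (𝓝 (∫ x in (0 : ℝ)..1, f x)) := by
  rw [Metric.tendsto_atTop]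
  intro ε hε
  have huc := isCompact_Icc.uniformContinuousOn_of_continuous hf
  rw [Metric.uniformContinuousOn_iff] at huc
  obtain ⟨δ, hδ, h⟩ := huc (ε / 2) (by positivity)
  obtain ⟨N₀, hN₀⟩ := exists_nat_one_div_lt hδ
  refine ⟨N₀ + 1, fun N hN => ?_⟩
  have hNpos : 0 < N := by omega
  have hN' : (0 : ℝ) < N := by exact_mod_cast hNpos
  have hNδ : 1 / (N : ℝ) < δ := lt_of_le_of_lt (by
    apply one_div_le_one_div_of_le (by positivity)
    exact_mod_cast hN) hN₀
  rw [Real.dist_eq]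
  refine lt_of_le_of_lt (abs_riemann_sum_sub_integral_le hNpos
    (hf.intervalIntegrable_of_Icc zero_le_one) (ε := ε / 2) ?_) (by linarith)
  intro m hm x hx
  have hm1 : ((m : ℝ) + 1) / N ≤ 1 := by
    rw [div_le_one hN']; exact_mod_cast hm
  have hm0 : (0 : ℝ) ≤ (m : ℝ) / N := by positivity
  have hlen : ((m + 1 : ℝ) / N) = (m : ℝ) / N + 1 / N := by ring
  have h1 : (m : ℝ) / N ≤ ((m : ℝ) + 1) / N := by gcongr; linarith
  have := h x ⟨hm0.trans hx.1, hx.2.trans hm1⟩ (m / N) ⟨hm0, h1.trans hm1⟩ (by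
    rw [Real.dist_eq, abs_of_nonneg (by linarith [hx.1])]
    linarith [hx.2])
  rw [Real.dist_eq] at this
  exact this.le

lemma tendsto_riemann_sum_two {K : ℝ → ℝ → ℝ} (hK : Continuous (Function.uncurry K)) :
    Tendsto (fun N : ℕ => (1 / (N : ℝ)) ^ 2 *
      ∑ m ∈ Finset.range N, ∑ l ∈ Finset.range N, K ((m : ℝ) / N) ((l : ℝ) / N)) atTop
      (𝓝 (∫ x in (0 : ℝ)..1, ∫ y in (0 : ℝ)..1, K x y)) := by
  have hcont : Continuous fun x => ∫ y in (0 : ℝ)..1, K x y :=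
    intervalIntegral.continuous_parametric_intervalIntegral_of_continuous' hK 0 1
  have hKx : ∀ x, Continuous (K x) := fun x => hK.comp (by fun_prop : Continuous fun y => (x, y))
  have h1 := tendsto_riemann_sum hcont.continuousOn
  rw [Metric.tendsto_atTop] at h1 ⊢
  intro ε hε
  have huc :=
    (isCompact_Icc.prod (isCompact_Icc (a := (0 : ℝ)) (b := 1))).uniformContinuousOn_of_continuous
    (s := (Icc (0 : ℝ) 1) ×ˢ (Icc (0 : ℝ) 1)) hK.continuousOn
  rw [Metric.uniformContinuousOn_iff] at huc
  obtain ⟨δ, hδ, h⟩ := huc (ε / 2) (by positivity)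
  obtain ⟨N₀, hN₀⟩ := exists_nat_one_div_lt hδ
  obtain ⟨N₁, hN₁⟩ := h1 (ε / 2) (by positivity)
  refine ⟨max N₁ (N₀ + 1), fun N hN => ?_⟩
  have hNpos : 0 < N := by have := le_max_right N₁ (N₀ + 1); omega
  have hN' : (0 : ℝ) < N := by exact_mod_cast hNpos
  have hNδ : 1 / (N : ℝ) < δ := lt_of_le_of_lt (by
    apply one_div_le_one_div_of_le (by positivity)
    exact_mod_cast (le_max_right _ _).trans hN) hN₀
  have h2 := hN₁ N ((le_max_left _ _).trans hN)
  rw [Real.dist_eq] at h2 ⊢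
  have hrow : ∀ k < N, |1 / (N : ℝ) * ∑ l ∈ Finset.range N, K ((k : ℝ) / N) ((l : ℝ) / N) -
      ∫ y in (0 : ℝ)..1, K ((k : ℝ) / N) y| ≤ ε / 2 := by
    intro k hk
    refine abs_riemann_sum_sub_integral_le hNpos ((hKx _).intervalIntegrable _ _) ?_
    intro m hm x hx
    have hk1 : (k : ℝ) / N ≤ 1 := by
      rw [div_le_one hN']; exact_mod_cast hk.le
    have hk0 : (0 : ℝ) ≤ (k : ℝ) / N := by positivity
    have hm1 : ((m : ℝ) + 1) / N ≤ 1 := by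
      rw [div_le_one hN']; exact_mod_cast hm
    have hm0 : (0 : ℝ) ≤ (m : ℝ) / N := by positivity
    have hlen : ((m + 1 : ℝ) / N) = (m : ℝ) / N + 1 / N := by ring
    have h1 : (m : ℝ) / N ≤ ((m : ℝ) + 1) / N := by gcongr; linarith
    have := h ((k : ℝ) / N, x) ⟨⟨hk0, hk1⟩, ⟨hm0.trans hx.1, hx.2.trans hm1⟩⟩
      ((k : ℝ) / N, m / N) ⟨⟨hk0, hk1⟩, ⟨hm0, h1.trans hm1⟩⟩ (by
      rw [Prod.dist_eq, dist_self, Real.dist_eq, abs_of_nonneg (by linarith [hx.1])]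
      exact max_lt hδ (by linarith [hx.2]))
    rw [Real.dist_eq] at this
    exact this.le
  have h3 : |(1 / (N : ℝ)) ^ 2 *
      ∑ m ∈ Finset.range N, ∑ l ∈ Finset.range N, K ((m : ℝ) / N) ((l : ℝ) / N) -
      1 / (N : ℝ) * ∑ m ∈ Finset.range N, ∫ y in (0 : ℝ)..1, K ((m : ℝ) / N) y| ≤ ε / 2 := by
    have : (1 / (N : ℝ)) ^ 2 *
      ∑ m ∈ Finset.range N, ∑ l ∈ Finset.range N, K ((m : ℝ) / N) ((l : ℝ) / N) -
      1 / (N : ℝ) * ∑ m ∈ Finset.range N, ∫ y in (0 : ℝ)..1, K ((m : ℝ) / N) y =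
      1 / (N : ℝ) * ∑ m ∈ Finset.range N, (1 / (N : ℝ) *
        ∑ l ∈ Finset.range N, K ((m : ℝ) / N) ((l : ℝ) / N) -
          ∫ y in (0 : ℝ)..1, K ((m : ℝ) / N) y) := by
      rw [Finset.sum_sub_distrib, mul_sub, ← Finset.mul_sum]
      ring
    rw [this, abs_mul, abs_of_pos (by positivity)]
    calc _ ≤ 1 / (N : ℝ) * ∑ m ∈ Finset.range N, ε / 2 := by
          gcongr
          refine (Finset.abs_sum_le_sum_abs _ _).trans (Finset.sum_le_sum fun m hm => ?_)
          exact hrow m (Finset.mem_range.1 hm)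
      _ = ε / 2 := by
          rw [Finset.sum_const, Finset.card_range, nsmul_eq_mul]; field_simp
  calc _ ≤ _ := abs_sub_le _ _ _
    _ < ε / 2 + ε / 2 := add_lt_add_of_le_of_lt h3 h2
    _ = ε := by ring

/-! ### Limits of Gaussian laws -/

lemma map_eq_gaussianReal_of_tendsto {Ω : Type*} [MeasurableSpace Ω] {P : Measure Ω}
    [IsProbabilityMeasure P] {R : ℕ → Ω → ℝ} {R' : Ω → ℝ} {v : ℕ → ℝ} {v' : ℝ}
    (hR : ∀ N, AEMeasurable (R N) P)
    (hlaw : ∀ N, P.map (R N) = gaussianReal 0 (Real.toNNReal (v N)))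
    (hlim : ∀ᵐ ω ∂P, Tendsto (fun N => R N ω) atTop (𝓝 (R' ω)))
    (hv : Tendsto v atTop (𝓝 v')) :
    P.map R' = gaussianReal 0 (Real.toNNReal v') := by
  have hR' : AEMeasurable R' P := aemeasurable_of_tendsto_metrizable_ae _ hR hlim
  have : IsProbabilityMeasure (P.map R') := Measure.isProbabilityMeasure_map hR'
  apply Measure.ext_of_charFun
  funext t
  have h1 : Tendsto (fun N => charFun (P.map (R N)) t) atTop (𝓝 (charFun (P.map R') t)) := by
    simp only [charFun_apply_real]
    have hexp : Continuous fun x : ℝ => Complex.exp (t * x * Complex.I) := by fun_prop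
    have hm : ∀ S : Ω → ℝ, AEMeasurable S P → ∫ x, Complex.exp (t * x * Complex.I) ∂(P.map S)
        = ∫ ω, Complex.exp (t * S ω * Complex.I) ∂P := by
      intro S hS
      rw [integral_map hS]
      exact hexp.aestronglyMeasurable
    simp_rw [fun N => hm (R N) (hR N), hm R' hR']
    refine tendsto_integral_of_dominated_convergence (fun _ => 1) ?_ (by simp) ?_ ?_
    · intro N
      exact (hexp.measurable.comp_aemeasurable (hR N)).aestronglyMeasurable
    · intro N
      filter_upwards with ω
      rw [← Complex.ofReal_mul, Complex.norm_exp_ofReal_mul_I]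
    · filter_upwards [hlim] with ω hω
      exact (hexp.tendsto _).comp hω
  have h2 : Tendsto (fun N => charFun (P.map (R N)) t) atTop
      (𝓝 (charFun (gaussianReal 0 (Real.toNNReal v')) t)) := by
    simp_rw [hlaw, charFun_gaussianReal]
    have h3 : Tendsto (fun N => ((Real.toNNReal (v N) : ℝ) : ℂ)) atTop
        (𝓝 ((Real.toNNReal v' : ℝ) : ℂ)) := by
      have : Continuous fun x : ℝ => ((Real.toNNReal x : ℝ) : ℂ) :=
        Complex.continuous_ofReal.comp (NNReal.continuous_coe.comp continuous_real_toNNReal)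
      exact (this.tendsto _).comp hv
    refine (Complex.continuous_exp.tendsto _).comp ?_
    exact tendsto_const_nhds.sub ((h3.mul_const _).div_const _)
  exact tendsto_nhds_unique h1 h2

/-! ### The integrated process -/

/-- Covariance of the integrated fractional Brownian motion `t ↦ ∫₀ᵗ W_s ds`. -/
noncomputable def intCov (H s t : ℝ) : ℝ :=
  s * t * ∫ x in (0 : ℝ)..1, ∫ y in (0 : ℝ)..1, fbmCov H (s * x) (t * y)

lemma continuous_fbmCov {H : ℝ} (hH : 0 < H) : Continuous (Function.uncurry (fbmCov H)) := by
  have h : ∀ f : ℝ × ℝ → ℝ, Continuous f → Continuous fun p => f p ^ (2 * H) :=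
    fun f hf => hf.rpow_const fun _ => Or.inr (by positivity)
  unfold fbmCov Function.uncurry
  exact (((h _ continuous_fst).add (h _ continuous_snd)).sub
    (h _ (continuous_fst.sub continuous_snd).abs)).div_const _

section IntegratedProcess

variable {Ω : Type*} [MeasurableSpace Ω] {P : Measure Ω}

lemma IsFBM.map_sum {H : ℝ} {W : ℝ → Ω → ℝ} (hW : IsFBM P H W) {ι : Type*} [Fintype ι]
    (t c : ι → ℝ) (ht : ∀ i, t i ∈ Icc (0 : ℝ) 1) :
    P.map (fun ω => ∑ i, c i * W (t i) ω) =
      gaussianReal 0 (Real.toNNReal (∑ i, ∑ j, c i * c j * fbmCov H (t i) (t j))) := by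
  classical
  let e := Fintype.equivFin ι
  have h := hW.2.2 (Fintype.card ι) (t ∘ e.symm) (c ∘ e.symm) (fun i => ht _)
  have h1 : ∀ ω, ∑ i, c i * W (t i) ω =
      ∑ i, (c ∘ e.symm) i * W ((t ∘ e.symm) i) ω := fun ω =>
    (Equiv.sum_comp e.symm fun i => c i * W (t i) ω).symm
  have h2 : ∑ i, ∑ j, c i * c j * fbmCov H (t i) (t j) =
      ∑ i, ∑ j, (c ∘ e.symm) i * (c ∘ e.symm) j *
        fbmCov H ((t ∘ e.symm) i) ((t ∘ e.symm) j) := by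
    rw [← Equiv.sum_comp e.symm]
    refine Finset.sum_congr rfl fun i _ => ?_
    rw [← Equiv.sum_comp e.symm]
    rfl
  simp_rw [h1, h2]
  exact h

lemma IsFBM.map_sum_integral [IsProbabilityMeasure P] {H : ℝ} (hH : 0 < H) {W : ℝ → Ω → ℝ}
    (hW : IsFBM P H W) {ι : Type*} [Fintype ι] (t c : ι → ℝ) (ht : ∀ i, t i ∈ Icc (0 : ℝ) 1) :
    P.map (fun ω => ∑ i, c i * ∫ s in (0 : ℝ)..(t i), W s ω) =
      gaussianReal 0 (Real.toNNReal (∑ i, ∑ j, c i * c j * intCov H (t i) (t j))) := by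
  have hunit : ∀ N : ℕ, ∀ m : Fin N, ((m : ℕ) : ℝ) / N ∈ Icc (0 : ℝ) 1 := fun N m =>
    ⟨by positivity, div_le_one_of_le₀ (by exact_mod_cast m.2.le) (by positivity)⟩
  have hmem : ∀ i, ∀ x ∈ Icc (0 : ℝ) 1, t i * x ∈ Icc (0 : ℝ) 1 := fun i x hx =>
    ⟨mul_nonneg (ht i).1 hx.1, mul_le_one₀ (ht i).2 hx.1 hx.2⟩
  refine map_eq_gaussianReal_of_tendsto
    (R := fun N ω => ∑ p : ι × Fin N, (c p.1 * t p.1 * (1 / (N : ℝ))) *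
      W (t p.1 * (((p.2 : ℕ) : ℝ) / N)) ω)
    (v := fun N => ∑ p : ι × Fin N, ∑ q : ι × Fin N,
      (c p.1 * t p.1 * (1 / (N : ℝ))) * (c q.1 * t q.1 * (1 / (N : ℝ))) *
        fbmCov H (t p.1 * (((p.2 : ℕ) : ℝ) / N)) (t q.1 * (((q.2 : ℕ) : ℝ) / N)))
    (fun N => ?_) (fun N => ?_) ?_ ?_
  · exact (Finset.measurable_sum _ fun p _ => (hW.1 _).const_mul _).aemeasurable
  · exact hW.map_sum (fun p : ι × Fin N => t p.1 * (((p.2 : ℕ) : ℝ) / N))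
      (fun p => c p.1 * t p.1 * (1 / (N : ℝ))) (fun p => hmem _ _ (hunit N p.2))
  · filter_upwards [hW.2.1] with ω hω
    simp_rw [Fintype.sum_prod_type]
    refine tendsto_finsetSum _ fun i _ => ?_
    have hc : ContinuousOn (fun x => W (t i * x) ω) (Icc 0 1) :=
      hω.comp (by fun_prop) (fun x hx => hmem i x hx)
    have h1 := (tendsto_riemann_sum hc).const_mul (c i * t i)
    have h2 : t i * ∫ x in (0 : ℝ)..1, W (t i * x) ω = ∫ s in (0 : ℝ)..(t i), W s ω := by
      have := intervalIntegral.smul_integral_comp_mul_left (a := 0) (b := 1) (fun s => W s ω) (t i)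
      simpa using this
    rw [mul_assoc, h2] at h1
    refine h1.congr fun N => ?_
    rw [← mul_assoc, Finset.mul_sum, Finset.sum_range]
  · simp_rw [Fintype.sum_prod_type]
    have hcomm : ∀ N : ℕ, ∑ i, ∑ m : Fin N, ∑ j, ∑ l : Fin N,
        c i * t i * (1 / (N : ℝ)) * (c j * t j * (1 / (N : ℝ))) *
          fbmCov H (t i * (((m : ℕ) : ℝ) / N)) (t j * (((l : ℕ) : ℝ) / N)) =
        ∑ i, ∑ j, c i * c j * (t i * t j * ((1 / (N : ℝ)) ^ 2 * ∑ m ∈ Finset.range N,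
          ∑ l ∈ Finset.range N, fbmCov H (t i * ((m : ℝ) / N)) (t j * ((l : ℝ) / N)))) := by
      intro N
      refine Finset.sum_congr rfl fun i _ => ?_
      rw [Finset.sum_comm]
      refine Finset.sum_congr rfl fun j _ => ?_
      simp_rw [Finset.sum_range, Finset.mul_sum]
      refine Finset.sum_congr rfl fun m _ => Finset.sum_congr rfl fun l _ => ?_
      ring
    simp_rw [hcomm]
    refine tendsto_finsetSum _ fun i _ => tendsto_finsetSum _ fun j _ => ?_
    refine Tendsto.const_mul _ (Tendsto.const_mul _ ?_)
    exact tendsto_riemann_sum_two (K := fun x y => fbmCov H (t i * x) (t j * y))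
      ((continuous_fbmCov hH).comp
        (by fun_prop : Continuous fun p : ℝ × ℝ => (t i * p.1, t j * p.2)))

lemma hasDerivAt_mul_abs_rpow (x : ℝ) {q : ℝ} (hq : 0 < q) :
    HasDerivAt (fun x : ℝ => x * |x| ^ q) ((q + 1) * |x| ^ q) x := by
  rcases eq_or_ne x 0 with rfl | hx
  · rw [hasDerivAt_iff_tendsto_slope]
    have h : Tendsto (fun y : ℝ => |y| ^ q) (𝓝[≠] 0) (𝓝 ((q + 1) * |(0 : ℝ)| ^ q)) := by
      have hc : Continuous fun y : ℝ => |y| ^ q := continuous_abs.rpow_const fun _ => Or.inr hq.le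
      have := hc.tendsto 0
      simp only [abs_zero, Real.zero_rpow hq.ne', mul_zero] at this ⊢
      exact this.mono_left nhdsWithin_le_nhds
    refine h.congr' ?_
    filter_upwards [self_mem_nhdsWithin] with y hy
    have hy' : y ≠ 0 := hy
    simp [slope_def_field, hy']
  · have h1 := (hasDerivAt_id x).mul ((hasDerivAt_abs hx).rpow_const (p := q)
      (Or.inl (abs_ne_zero.2 hx)))
    refine h1.congr_deriv ?_
    have hx' : 0 < |x| := abs_pos.2 hx
    have h2 : |x| ^ q = |x| ^ (q - 1) * |x| := by
      rw [← Real.rpow_add_one hx'.ne']; congr 1; ring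
    have h3 : x * (SignType.sign x : ℝ) = |x| := self_mul_sign x
    simp only [id]
    rw [h2, ← h3]
    ring

lemma integral_abs_sub_rpow {q : ℝ} (hq : 0 < q) (u t : ℝ) :
    ∫ v in (0 : ℝ)..t, |u - v| ^ q = ((t - u) * |t - u| ^ q + u * |u| ^ q) / (q + 1) := by
  have h : ∀ v, HasDerivAt (fun v : ℝ => (v - u) * |v - u| ^ q / (q + 1)) (|u - v| ^ q) v := by
    intro v
    have := ((hasDerivAt_mul_abs_rpow (v - u) hq).comp_sub_const v u).div_const (q + 1)
    refine this.congr_deriv ?_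
    rw [abs_sub_comm]; field_simp
  have hc : Continuous fun v : ℝ => |u - v| ^ q :=
    (by fun_prop : Continuous fun v : ℝ => |u - v|).rpow_const fun _ => Or.inr hq.le
  rw [intervalIntegral.integral_eq_sub_of_hasDerivAt (fun v _ => h v) (hc.intervalIntegrable _ _)]
  simp only [zero_sub, abs_neg]
  ring

lemma integral_mul_abs_sub_rpow {q : ℝ} (hq : 0 < q) (t s : ℝ) :
    ∫ u in (0 : ℝ)..s, (t - u) * |t - u| ^ q = (|t| ^ (q + 2) - |t - s| ^ (q + 2)) / (q + 2) := by
  have h : ∀ u, HasDerivAt (fun u : ℝ => -(|t - u| ^ (q + 2) / (q + 2))) ((t - u) * |t - u| ^ q) u := by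
    intro u
    have := (((hasDerivAt_abs_rpow (t - u) (by linarith : 1 < q + 2)).comp_const_sub t u).div_const
      (q + 2)).neg
    refine this.congr_deriv ?_
    rw [show q + 2 - 2 = q by ring]; field_simp
  have hc : Continuous fun u : ℝ => (t - u) * |t - u| ^ q :=
    (by fun_prop : Continuous fun u : ℝ => t - u).mul
    ((by fun_prop : Continuous fun u : ℝ => |t - u|).rpow_const fun _ => Or.inr hq.le)
  rw [intervalIntegral.integral_eq_sub_of_hasDerivAt (fun v _ => h v) (hc.intervalIntegrable _ _)]
  simp only [sub_zero]
  ring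

lemma intCov_eq {H : ℝ} (hH : 0 < H) {s t : ℝ} (hs : 0 ≤ s) (ht : 0 ≤ t) :
    intCov H s t = (t * s ^ (2 * H + 1) + s * t ^ (2 * H + 1)
      - (s ^ (2 * H + 2) + t ^ (2 * H + 2) - |s - t| ^ (2 * H + 2)) / (2 * H + 2)) /
        (2 * (2 * H + 1)) := by
  set q := 2 * H with hq
  have hq0 : 0 < q := by positivity
  have h1 : intCov H s t = ∫ u in (0 : ℝ)..s, ∫ v in (0 : ℝ)..t, fbmCov H u v := by
    have h := intervalIntegral.smul_integral_comp_mul_left (a := 0) (b := 1)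
      (fun u => ∫ v in (0 : ℝ)..t, fbmCov H u v) s
    simp only [mul_zero, mul_one, smul_eq_mul] at h
    rw [← h, intCov, mul_assoc, ← intervalIntegral.integral_const_mul]
    congr 1
    refine intervalIntegral.integral_congr fun x _ => ?_
    have h := intervalIntegral.smul_integral_comp_mul_left (a := 0) (b := 1)
      (fun v => fbmCov H (s * x) v) t
    simp
  have hrp : Continuous fun v : ℝ => v ^ q := Real.continuous_rpow_const hq0.le
  have h2 : ∀ u ∈ Set.uIcc 0 s, ∫ v in (0 : ℝ)..t, fbmCov H u v =
      (t * u ^ q + t ^ (q + 1) / (q + 1) -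
        ((t - u) * |t - u| ^ q - (0 - u) * |0 - u| ^ q) / (q + 1)) / 2 := by
    intro u hu
    have hc : Continuous fun v : ℝ => |u - v| ^ q :=
      (by fun_prop : Continuous fun v : ℝ => |u - v|).rpow_const fun _ => Or.inr hq0.le
    have i1 : IntervalIntegrable (fun v => u ^ q + v ^ q) volume 0 t :=
      (continuous_const.add hrp).intervalIntegrable _ _
    simp only [fbmCov, ← hq]
    rw [intervalIntegral.integral_div, intervalIntegral.integral_sub
      i1 (hc.intervalIntegrable _ _),
      intervalIntegral.integral_add (by simp) (hrp.intervalIntegrable _ _),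
      integral_rpow (Or.inl (by linarith)), integral_abs_sub_rpow hq0]
    simp [Real.zero_rpow (by linarith : q + 1 ≠ 0)]
  rw [h1, intervalIntegral.integral_congr h2, intervalIntegral.integral_div]
  have hc : ∀ t, Continuous fun u : ℝ => (t - u) * |t - u| ^ q := fun t =>
    (by fun_prop : Continuous fun u : ℝ => t - u).mul
    ((by fun_prop : Continuous fun u : ℝ => |t - u|).rpow_const fun _ => Or.inr hq0.le)
  have i1 : IntervalIntegrable (fun u => t * u ^ q + t ^ (q + 1) / (q + 1)) volume 0 s :=
    ((continuous_const.mul hrp).add continuous_const).intervalIntegrable _ _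
  have i2 : IntervalIntegrable (fun u => ((t - u) * |t - u| ^ q - (0 - u) * |0 - u| ^ q) / (q + 1))
      volume 0 s := (((hc t).sub (hc 0)).div_const _).intervalIntegrable _ _
  have i3 : IntervalIntegrable (fun u => t * u ^ q) volume 0 s :=
    (continuous_const.mul hrp).intervalIntegrable _ _
  rw [intervalIntegral.integral_sub i1 i2,
    intervalIntegral.integral_add i3 (by simp),
    intervalIntegral.integral_const_mul, integral_rpow (Or.inl (by linarith)),
    intervalIntegral.integral_div, intervalIntegral.integral_div, intervalIntegral.integral_sub
      ((hc t).intervalIntegrable _ _) ((hc 0).intervalIntegrable _ _),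
    integral_mul_abs_sub_rpow hq0, integral_mul_abs_sub_rpow hq0]
  simp only [intervalIntegral.integral_const, smul_eq_mul, sub_zero, zero_sub, abs_neg, abs_zero,
    Real.zero_rpow (by linarith : q + 1 ≠ 0), Real.zero_rpow (by linarith : q + 2 ≠ 0),
    abs_of_nonneg hs, abs_of_nonneg ht, abs_sub_comm t s]
  field_simp
  ring

end IntegratedProcess

/-! ### Third order differences and their covariances -/

/-- Nodes of the difference functional underlying the Faber–Schauder coefficients. -/
def fsNode : Fin 4 → ℝ := ![0, 1, 3, 4]

/-- Weights of the difference functional underlying the Faber–Schauder coefficients. -/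
def fsWeight : Fin 4 → ℝ := ![1, -2, 2, -1]

/-- The difference `F(t) - 2F(t+δ) + 2F(t+3δ) - F(t+4δ)`. -/
def fsDiff (F : ℝ → ℝ) (t δ : ℝ) : ℝ :=
  F t - 2 * F (t + δ) + 2 * F (t + 3 * δ) - F (t + 4 * δ)

/-- Normalised covariance of third order differences of integrated fractional Brownian motion. -/
noncomputable def fsCov (H r : ℝ) : ℝ :=
  (∑ a, ∑ b, fsWeight a * fsWeight b * |r + (fsNode a - fsNode b)| ^ (2 * H + 2)) /
    (2 * (2 * H + 1) * (2 * H + 2))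

lemma sum_fsWeight_eq_fsDiff (F : ℝ → ℝ) (t δ : ℝ) :
    ∑ a, fsWeight a * F (t + fsNode a * δ) = fsDiff F t δ := by
  simp [Fin.sum_univ_four, fsWeight, fsNode, fsDiff]
  ring

lemma sum_fsWeight_intCov {H : ℝ} (hH : 0 < H) {s t δ : ℝ} (hs : 0 ≤ s) (ht : 0 ≤ t)
    (hδ : 0 ≤ δ) :
    ∑ a, ∑ b, fsWeight a * fsWeight b * intCov H (s + fsNode a * δ) (t + fsNode b * δ) =
      (∑ a, ∑ b, fsWeight a * fsWeight b * |s - t + (fsNode a - fsNode b) * δ| ^ (2 * H + 2)) /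
        (2 * (2 * H + 1) * (2 * H + 2)) := by
  have hn : ∀ a, 0 ≤ fsNode a := by
    intro a; fin_cases a <;> simp [fsNode]
  have h : ∀ a b, intCov H (s + fsNode a * δ) (t + fsNode b * δ) = _ := fun a b =>
    intCov_eq hH (add_nonneg hs (mul_nonneg (hn a) hδ)) (add_nonneg ht (mul_nonneg (hn b) hδ))
  simp_rw [h]
  have h2 : ∀ a b, (s + fsNode a * δ) - (t + fsNode b * δ) =
      s - t + (fsNode a - fsNode b) * δ := fun a b => by ring
  simp_rw [h2]
  have hp1 : 2 * H + 1 ≠ 0 := by positivity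
  have hp2 : 2 * H + 2 ≠ 0 := by positivity
  generalize hA : (fun a => (s + fsNode a * δ) ^ (2 * H + 1)) = A
  generalize hA' : (fun a => (s + fsNode a * δ) ^ (2 * H + 2)) = A'
  generalize hB : (fun a => (t + fsNode a * δ) ^ (2 * H + 1)) = B
  generalize hB' : (fun a => (t + fsNode a * δ) ^ (2 * H + 2)) = B'
  generalize hC : (fun a b => |s - t + (fsNode a - fsNode b) * δ| ^ (2 * H + 2)) = C
  have e1 := fun a => congrFun hA a
  have e2 := fun a => congrFun hA' a
  have e3 := fun a => congrFun hB a
  have e4 := fun a => congrFun hB' a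
  have e5 := fun a b => congrFun (congrFun hC a) b
  simp only [e1, e2, e3, e4, e5]
  simp only [Fin.sum_univ_four, fsWeight, fsNode]
  simp
  field_simp
  ring

lemma sum_fsWeight_intCov_dyadic {H : ℝ} (hH : 0 < H) {δ : ℝ} (hδ : 0 ≤ δ) (j k : ℕ) :
    ∑ a, ∑ b, fsWeight a * fsWeight b *
      intCov H (4 * j * δ + fsNode a * δ) (4 * k * δ + fsNode b * δ) =
      δ ^ (2 * H + 2) * fsCov H (4 * ((j : ℤ) - (k : ℤ) : ℤ)) := by
  rw [sum_fsWeight_intCov hH (by positivity) (by positivity) hδ, fsCov, ← mul_div_assoc,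
    Finset.mul_sum]
  congr 1
  refine Finset.sum_congr rfl fun a _ => ?_
  rw [Finset.mul_sum]
  refine Finset.sum_congr rfl fun b _ => ?_
  have : 4 * (j : ℝ) * δ - 4 * k * δ + (fsNode a - fsNode b) * δ =
      δ * (4 * (((j : ℤ) - (k : ℤ) : ℤ) : ℝ) + (fsNode a - fsNode b)) := by
    push_cast; ring
  rw [this, abs_mul, abs_of_nonneg hδ, Real.mul_rpow hδ (abs_nonneg _)]
  ring

lemma fsCov_neg (H r : ℝ) : fsCov H (-r) = fsCov H r := by
  unfold fsCov
  congr 1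
  rw [Finset.sum_comm]
  refine Finset.sum_congr rfl fun a _ => Finset.sum_congr rfl fun b _ => ?_
  rw [← abs_neg, mul_comm (fsWeight b)]
  congr 3
  ring

lemma fsCov_zero_pos {H : ℝ} (hH : H ∈ Ioo (0 : ℝ) 1) : 0 < fsCov H 0 := by
  have h0 := hH.1
  have hs := (Real.strictConcaveOn_rpow hH.1 hH.2).2
  have hconc := hs (show (4 : ℝ) ∈ Ici 0 by simp) (show (1 : ℝ) ∈ Ici 0 by simp) (by norm_num)
    (show (0 : ℝ) < 2 / 3 by norm_num) (show (0 : ℝ) < 1 / 3 by norm_num) (by norm_num)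
  norm_num at hconc
  have hpow : ∀ x : ℝ, 0 < x → x ^ (2 * H + 2) = (x ^ H) ^ 2 * x ^ 2 := by
    intro x hx
    rw [Real.rpow_add hx, mul_comm 2 H, Real.rpow_mul hx.le]
    norm_cast
  have h4 : (4 : ℝ) ^ H = (2 ^ H) ^ 2 := by
    rw [show (4 : ℝ) = 2 ^ (2 : ℝ) by norm_num, ← Real.rpow_mul (by norm_num), mul_comm,
      Real.rpow_mul (by norm_num)]
    norm_cast
  have h2 : 0 < (2 : ℝ) ^ H := by positivity
  unfold fsCov
  apply div_pos _ (by positivity)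
  simp only [Fin.sum_univ_four, fsWeight, fsNode]
  simp [Real.zero_rpow (by linarith : 2 * H + 2 ≠ 0)]
  norm_num
  rw [hpow 3 (by norm_num), hpow 4 (by norm_num), hpow 2 (by norm_num)]
  rw [h4] at hconc ⊢
  nlinarith [sq_nonneg ((2 : ℝ) ^ H)]

lemma abs_sub_le_of_hasDerivAt_le {f f' : ℝ → ℝ} {r x y M : ℝ}
    (hf : ∀ z ∈ Icc r x, HasDerivAt f (f' z) z) (hM : ∀ z ∈ Icc r x, |f' z| ≤ M)
    (hy : y ∈ Icc r x) : |f y - f r| ≤ M * (y - r) := by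
  have h := (convex_Icc r x).norm_image_sub_le_of_norm_hasDerivWithin_le (f := f) (f' := f')
    (C := M) (fun z hz => (hf z hz).hasDerivWithinAt) hM ⟨le_rfl, hy.1.trans hy.2⟩ hy
  rwa [Real.norm_eq_abs, Real.norm_eq_abs, abs_of_nonneg (sub_nonneg.2 hy.1)] at h

lemma abs_taylor_two_le {f f₁ f₂ f₃ : ℝ → ℝ} {r x M : ℝ} (hM : 0 ≤ M) (hx : r ≤ x)
    (h1 : ∀ z ∈ Icc r x, HasDerivAt f (f₁ z) z) (h2 : ∀ z ∈ Icc r x, HasDerivAt f₁ (f₂ z) z)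
    (h3 : ∀ z ∈ Icc r x, HasDerivAt f₂ (f₃ z) z) (h4 : ∀ z ∈ Icc r x, |f₃ z| ≤ M) :
    |f x - f r - f₁ r * (x - r) - f₂ r * (x - r) ^ 2 / 2| ≤ M * (x - r) ^ 3 := by
  have hx0 : 0 ≤ x - r := sub_nonneg.2 hx
  have e2 : ∀ z ∈ Icc r x, |f₂ z - f₂ r| ≤ M * (x - r) := fun z hz =>
    (abs_sub_le_of_hasDerivAt_le h3 h4 hz).trans (by have := hz.2; gcongr)
  have e1 : ∀ z ∈ Icc r x, |f₁ z - f₁ r - f₂ r * (z - r)| ≤ M * (x - r) ^ 2 := by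
    intro z hz
    have := abs_sub_le_of_hasDerivAt_le (f := fun z => f₁ z - f₁ r - f₂ r * (z - r))
      (f' := fun z => f₂ z - f₂ r) (fun z hz => by
        refine (((h2 z hz).sub_const _).sub
          (((hasDerivAt_id z).sub_const r).const_mul (f₂ r))).congr_deriv ?_
        ring) e2 hz
    simp only [sub_self, mul_zero, sub_zero] at this
    refine this.trans ?_
    have : z - r ≤ x - r := by linarith [hz.2]
    calc _ ≤ M * (x - r) * (x - r) := by gcongr
      _ = _ := by ring
  have := abs_sub_le_of_hasDerivAt_le (f := fun z => f z - f r - f₁ r * (z - r) -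
      f₂ r * (z - r) ^ 2 / 2) (f' := fun z => f₁ z - f₁ r - f₂ r * (z - r)) (fun z hz => by
        refine ((((h1 z hz).sub_const _).sub
          (((hasDerivAt_id z).sub_const r).const_mul (f₁ r))).sub
          (((((hasDerivAt_id z).sub_const r).pow 2).const_mul (f₂ r)).div_const 2)).congr_deriv ?_
        simp only [id]
        ring) e1 (right_mem_Icc.2 hx)
  simp only [sub_self, mul_zero, sub_zero, ne_eq, OfNat.ofNat_ne_zero, not_false_eq_true,
    zero_pow, zero_div] at this
  refine this.trans (le_of_eq (by ring))

lemma abs_fsDiff_le {f f₁ f₂ f₃ : ℝ → ℝ} {r M : ℝ} (hM : 0 ≤ M)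
    (h1 : ∀ z ∈ Icc r (r + 4), HasDerivAt f (f₁ z) z)
    (h2 : ∀ z ∈ Icc r (r + 4), HasDerivAt f₁ (f₂ z) z)
    (h3 : ∀ z ∈ Icc r (r + 4), HasDerivAt f₂ (f₃ z) z)
    (h4 : ∀ z ∈ Icc r (r + 4), |f₃ z| ≤ M) : |fsDiff f r 1| ≤ 120 * M := by
  have h : ∀ x, 0 ≤ x → x ≤ 4 →
      |f (r + x) - f r - f₁ r * x - f₂ r * x ^ 2 / 2| ≤ M * x ^ 3 := by
    intro x hx0 hx4
    have hs : Icc r (r + x) ⊆ Icc r (r + 4) := Icc_subset_Icc_right (by linarith)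
    have := abs_taylor_two_le hM (by linarith : r ≤ r + x) (fun z hz => h1 z (hs hz))
      (fun z hz => h2 z (hs hz)) (fun z hz => h3 z (hs hz)) (fun z hz => h4 z (hs hz))
    simpa using this
  have a1 := abs_le.1 (h 1 (by norm_num) (by norm_num))
  have a3 := abs_le.1 (h 3 (by norm_num) (by norm_num))
  have a4 := abs_le.1 (h 4 (by norm_num) (by norm_num))
  simp only [fsDiff, mul_one]
  rw [abs_le]
  constructor <;> linarith [a1.1, a1.2, a3.1, a3.2, a4.1, a4.2]

lemma fsDiff_hasDerivAt {f f' : ℝ → ℝ} {z : ℝ}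
    (h : ∀ x ∈ Icc (z - 4) z, HasDerivAt f (f' x) x) :
    HasDerivAt (fun z => fsDiff f (z - 4) 1) (fsDiff f' (z - 4) 1) z := by
  have hx : ∀ c, 0 ≤ c → c ≤ 4 → HasDerivAt (fun z => f (z - c)) (f' (z - c)) z :=
    fun c hc0 hc4 => (h (z - c) ⟨by linarith, by linarith⟩).comp_sub_const z c
  have e : ∀ f : ℝ → ℝ, ∀ z, fsDiff f (z - 4) 1 =
      f (z - 4) - 2 * f (z - 3) + 2 * f (z - 1) - f (z - 0) := by
    intro f z
    rw [fsDiff, show z - 4 + 1 = z - 3 by ring, show z - 4 + 3 * 1 = z - 1 by ring,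
      show z - 4 + 4 * 1 = z - 0 by ring]
  simp_rw [e]
  exact (((hx 4 (by norm_num) le_rfl).sub ((hx 3 (by norm_num) (by norm_num)).const_mul 2)).add
    ((hx 1 (by norm_num) (by norm_num)).const_mul 2)).sub (hx 0 le_rfl (by norm_num))

lemma abs_fsCov_le {H : ℝ} (hH : H ∈ Ioo (0 : ℝ) 1) :
    ∃ K, 0 ≤ K ∧ ∀ r, 5 ≤ r → |fsCov H r| ≤ K * (r - 4) ^ (-2 : ℝ) := by
  set p := 2 * H + 2 with hp
  -- the `k`-th derivative of `x ^ p`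
  let c : ℕ → ℝ := fun k => ∏ i ∈ Finset.range k, (p - i)
  have hder : ∀ k : ℕ, ∀ x, 0 < x →
      HasDerivAt (fun x : ℝ => c k * x ^ (p - k)) (c (k + 1) * x ^ (p - (k + 1 : ℕ))) x := by
    intro k x hx
    refine ((Real.hasDerivAt_rpow_const (p := p - k) (Or.inl hx.ne')).const_mul (c k)).congr_deriv ?_
    simp only [c, Finset.prod_range_succ]
    push_cast
    rw [show p - ((k : ℝ) + 1) = p - k - 1 by ring]
    ring
  let φ : ℕ → ℝ → ℝ := fun k x => c k * x ^ (p - k)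
  refine ⟨120 * (120 * |c 6|) , by positivity, fun r hr => ?_⟩
  have hsix : ∀ z, r - 4 ≤ z → |φ 6 z| ≤ |c 6| * (r - 4) ^ (-2 : ℝ) := by
    intro z hz
    have hr1 : 1 ≤ r - 4 := by linarith
    simp only [φ]
    rw [abs_mul, abs_of_nonneg (a := z ^ _) (Real.rpow_nonneg (by linarith) _)]
    gcongr
    calc z ^ (p - (6 : ℕ)) ≤ z ^ (-2 : ℝ) := by
          apply Real.rpow_le_rpow_of_exponent_le (by linarith)
          push_cast
          linarith [hH.2]
      _ ≤ _ := Real.rpow_le_rpow_of_nonpos (by linarith) hz (by norm_num)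
  have hinner : ∀ z ∈ Icc r (r + 4), |fsDiff (φ 3) (z - 4) 1| ≤
      120 * (|c 6| * (r - 4) ^ (-2 : ℝ)) := by
    intro z hz
    have hpos : ∀ y ∈ Icc (z - 4) (z - 4 + 4), 0 < y := fun y hy => by linarith [hy.1, hz.1]
    refine abs_fsDiff_le (mul_nonneg (abs_nonneg _) (Real.rpow_nonneg (by linarith) _))
      (fun y hy => hder 3 y (hpos y hy)) (fun y hy => hder 4 y (hpos y hy))
      (fun y hy => hder 5 y (hpos y hy)) (fun y hy => hsix y (by linarith [hy.1, hz.1]))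
  have hd : ∀ k : ℕ, ∀ z ∈ Icc r (r + 4),
      HasDerivAt (fun z => fsDiff (φ k) (z - 4) 1) (fsDiff (φ (k + 1)) (z - 4) 1) z := by
    intro k z hz
    exact fsDiff_hasDerivAt fun x hx => hder k x (by linarith [hx.1, hz.1])
  have houter := abs_fsDiff_le (f := fun z => fsDiff (φ 0) (z - 4) 1)
    (mul_nonneg (by norm_num) (mul_nonneg (abs_nonneg _) (Real.rpow_nonneg (by linarith) _)))
    (hd 0) (hd 1) (hd 2) hinner
  have heq : fsCov H r = -fsDiff (fun z => fsDiff (φ 0) (z - 4) 1) r 1 /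
      (2 * (2 * H + 1) * (2 * H + 2)) := by
    unfold fsCov
    congr 1
    have habs : ∀ a b, |r + (fsNode a - fsNode b)| ^ (2 * H + 2) =
        φ 0 (r + (fsNode a - fsNode b)) := by
      intro a b
      have h1 : 0 ≤ fsNode a := by fin_cases a <;> simp [fsNode]
      have h2 : fsNode b ≤ 4 := by fin_cases b <;> norm_num [fsNode]
      rw [abs_of_nonneg (by linarith)]
      simp [φ, c, hp]
    simp_rw [habs]
    simp only [Fin.sum_univ_four, fsDiff]
    simp [fsWeight, fsNode]
    ring_nf
  have hden : 1 ≤ 2 * (2 * H + 1) * (2 * H + 2) := by nlinarith [hH.1]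
  rw [heq, abs_div, abs_neg, abs_of_pos (by linarith : 0 < 2 * (2 * H + 1) * (2 * H + 2))]
  refine (div_le_self (abs_nonneg _) hden).trans (houter.trans (le_of_eq (by ring)))

lemma summable_fsCov_sq {H : ℝ} (hH : H ∈ Ioo (0 : ℝ) 1) :
    Summable fun d : ℤ => fsCov H (4 * d) ^ 2 := by
  obtain ⟨K, hK, h⟩ := abs_fsCov_le hH
  have hs : Summable fun d : ℤ => K ^ 2 * (1 / (d : ℝ) ^ 4) :=
    ((Real.summable_one_div_int_pow (p := 4)).2 (by norm_num)).mul_left _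
  refine hs.of_norm_bounded_eventually ?_
  have hfin : (Set.Icc (-1 : ℤ) 1).Finite := Set.finite_Icc _ _
  filter_upwards [hfin.compl_mem_cofinite] with d hd
  have key : ∀ x : ℝ, 2 ≤ x → fsCov H (4 * x) ^ 2 ≤ K ^ 2 * (1 / x ^ 4) := by
    intro x hx
    have h1 := h (4 * x) (by linarith)
    have h2 : (4 * x - 4) ^ (-2 : ℝ) ≤ x ^ (-2 : ℝ) :=
      Real.rpow_le_rpow_of_nonpos (by linarith) (by linarith) (by norm_num)
    rw [← sq_abs]
    calc _ ≤ (K * x ^ (-2 : ℝ)) ^ 2 := by gcongr; exact h1.trans (by gcongr)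
      _ = _ := by
        rw [Real.rpow_neg (by linarith)]
        norm_cast
        field_simp
  rw [Real.norm_eq_abs, abs_of_nonneg (sq_nonneg _)]
  simp only [Set.mem_compl_iff, Set.mem_Icc, not_and_or, not_le] at hd
  rcases hd with hd | hd
  · have := key (-d) (by
      have : d ≤ -2 := by omega
      have : (d : ℝ) ≤ -2 := by exact_mod_cast this
      linarith)
    rw [mul_neg, fsCov_neg] at this
    refine this.trans (le_of_eq (by ring))
  · exact key d (by exact_mod_cast (by omega : (2 : ℤ) ≤ d))

/-! ### Gaussian moments -/

lemma integral_pow_four_gaussianReal (v : NNReal) :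
    ∫ x, x ^ 4 ∂(gaussianReal 0 v) = 3 * (v : ℝ) ^ 2 := by
  have h := iteratedDeriv_mgf_zero (X := fun x : ℝ => x) (μ := gaussianReal 0 v)
    (by rw [integrableExpSet_fun_id_gaussianReal]; simp) 4
  simp only [Pi.pow_apply] at h
  rw [← h, mgf_fun_id_gaussianReal]
  have he : ∀ (f f' : ℝ → ℝ), (∀ t, HasDerivAt f (f' t) t) →
      deriv (fun t => f t * Real.exp (0 * t + v * t ^ 2 / 2)) =
        fun t => (f' t + f t * (v * t)) * Real.exp (0 * t + v * t ^ 2 / 2) := by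
    intro f f' hf
    funext t
    have h1 : HasDerivAt (fun t : ℝ => 0 * t + v * t ^ 2 / 2) (v * t) t := by
      refine (((hasDerivAt_id t).const_mul 0).add
        ((((hasDerivAt_id t).pow 2).const_mul (v : ℝ)).div_const 2)).congr_deriv ?_
      simp
      ring
    refine ((hf t).mul h1.exp).deriv.trans ?_
    ring
  have h0 : (fun t : ℝ => Real.exp (0 * t + v * t ^ 2 / 2)) =
      fun t => (fun _ => (1 : ℝ)) t * Real.exp (0 * t + v * t ^ 2 / 2) := by simp
  rw [iteratedDeriv_succ', iteratedDeriv_succ', iteratedDeriv_succ', iteratedDeriv_succ',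
    iteratedDeriv_zero, h0, he (fun _ => 1) (fun _ => 0) (fun t => hasDerivAt_const _ _),
    he (fun t => 0 + 1 * (v * t)) (fun _ => v) (fun t => by
      simpa using (hasDerivAt_id t).const_mul (v : ℝ)),
    he (fun t => v + (0 + 1 * (v * t)) * (v * t)) (fun t => 2 * v ^ 2 * t) (fun t => by
      have := ((hasDerivAt_id t).pow 2).const_mul ((v : ℝ) ^ 2)
      simp only [Pi.pow_apply, id] at this
      have h2 := this.const_add (v : ℝ)
      refine (h2.congr_deriv (f' := _) ?_).congr_of_eventuallyEq
        (Eventually.of_forall fun t => ?_)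
      · simp; ring
      · simp; ring),
    he (fun t => 2 * v ^ 2 * t + (v + (0 + 1 * (v * t)) * (v * t)) * (v * t))
      (fun t => 3 * v ^ 2 + 3 * v ^ 3 * t ^ 2) (fun t => by
      have := ((hasDerivAt_id t).const_mul (3 * (v : ℝ) ^ 2)).add
        (((hasDerivAt_id t).pow 3).const_mul ((v : ℝ) ^ 3))
      refine (this.congr_deriv (f' := _) ?_).congr_of_eventuallyEq
        (Eventually.of_forall fun t => ?_)
      · simp; ring
      · simp; ring)]
  simp

lemma integral_sq_gaussianReal (v : NNReal) : ∫ x, x ^ 2 ∂(gaussianReal 0 v) = v := by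
  have h := variance_id_gaussianReal (μ := 0) (v := v)
  rw [variance_of_integral_eq_zero (by fun_prop) (by simp)] at h
  simpa using h

lemma integral_pow_even_gaussianReal (p : ℕ) (v : NNReal) :
    ∫ x, x ^ (2 * p) ∂(gaussianReal 0 v) = (v : ℝ) ^ p * ∫ x, x ^ (2 * p) ∂(gaussianReal 0 1) := by
  have h := gaussianReal_map_const_mul (μ := 0) (v := 1) (Real.sqrt v)
  have hv : (NNReal.mk (Real.sqrt v ^ 2) (sq_nonneg _) * 1 : NNReal) = v := by
    ext; simp
  rw [mul_zero, hv] at h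
  rw [← h, integral_map (by fun_prop) (by fun_prop)]
  simp_rw [mul_pow, integral_const_mul]
  congr 1
  rw [pow_mul, Real.sq_sqrt v.coe_nonneg]

section GaussianVariables

variable {Ω : Type*} [MeasurableSpace Ω] {P : Measure Ω}

lemma aemeasurable_of_map_gaussianReal {Z : Ω → ℝ} {v : NNReal}
    (h : P.map Z = gaussianReal 0 v) : AEMeasurable Z P :=
  aemeasurable_of_map_neZero (by rw [h]; exact IsProbabilityMeasure.neZero _)

lemma integrable_pow_of_map_gaussianReal {Z : Ω → ℝ} {v : NNReal}
    (h : P.map Z = gaussianReal 0 v) (n : ℕ) : Integrable (fun ω => Z ω ^ n) P := by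
  have hZ := aemeasurable_of_map_gaussianReal h
  have h1 : Integrable (fun x : ℝ => x ^ n) (P.map Z) := by
    rw [h]
    have := (memLp_id_gaussianReal (μ := 0) (v := v) n).integrable_norm_pow'
    exact this.mono' (by fun_prop) (Eventually.of_forall fun x => by simp)
  exact (integrable_map_measure (continuous_pow n).aestronglyMeasurable hZ).1 h1

lemma integral_pow_of_map_gaussianReal {Z : Ω → ℝ} {v : NNReal}
    (h : P.map Z = gaussianReal 0 v) (n : ℕ) :
    ∫ ω, Z ω ^ n ∂P = ∫ x, x ^ n ∂(gaussianReal 0 v) := by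
  rw [← h, integral_map (aemeasurable_of_map_gaussianReal h) (by fun_prop)]

lemma integral_sq_mul_sq_le [IsProbabilityMeasure P] {Z₁ Z₂ : Ω → ℝ} {v c : ℝ} (hv : 0 ≤ v)
    (h : ∀ x y : ℝ, P.map (fun ω => x * Z₁ ω + y * Z₂ ω) =
      gaussianReal 0 (Real.toNNReal (x ^ 2 * v + 2 * x * y * c + y ^ 2 * v))) :
    Integrable (fun ω => Z₁ ω ^ 2 * Z₂ ω ^ 2) P ∧
      ∫ ω, Z₁ ω ^ 2 * Z₂ ω ^ 2 ∂P ≤ v ^ 2 + 2 * c ^ 2 := by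
  have hI : ∀ x y : ℝ, Integrable (fun ω => (x * Z₁ ω + y * Z₂ ω) ^ 4) P := fun x y =>
    integrable_pow_of_map_gaussianReal (h x y) 4
  have hE : ∀ x y : ℝ, ∫ ω, (x * Z₁ ω + y * Z₂ ω) ^ 4 ∂P =
      3 * (Real.toNNReal (x ^ 2 * v + 2 * x * y * c + y ^ 2 * v) : ℝ) ^ 2 := fun x y => by
    rw [integral_pow_of_map_gaussianReal (h x y) 4, integral_pow_four_gaussianReal]
  have heq : (fun ω => Z₁ ω ^ 2 * Z₂ ω ^ 2) = fun ω =>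
      1 / 12 * ((1 * Z₁ ω + 1 * Z₂ ω) ^ 4 + (1 * Z₁ ω + (-1) * Z₂ ω) ^ 4 -
        2 * (1 * Z₁ ω + 0 * Z₂ ω) ^ 4 - 2 * (0 * Z₁ ω + 1 * Z₂ ω) ^ 4) := by
    funext ω; ring
  rw [heq]
  have i1 : Integrable (fun ω => (1 * Z₁ ω + 1 * Z₂ ω) ^ 4 + (1 * Z₁ ω + (-1) * Z₂ ω) ^ 4) P :=
    (hI 1 1).add (hI 1 (-1))
  have i2 : Integrable (fun ω => (1 * Z₁ ω + 1 * Z₂ ω) ^ 4 + (1 * Z₁ ω + (-1) * Z₂ ω) ^ 4 -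
      2 * (1 * Z₁ ω + 0 * Z₂ ω) ^ 4) P := i1.sub ((hI 1 0).const_mul 2)
  refine ⟨(i2.sub ((hI 0 1).const_mul 2)).const_mul _, ?_⟩
  rw [integral_const_mul, integral_sub i2 ((hI 0 1).const_mul 2),
    integral_sub i1 ((hI 1 0).const_mul 2), integral_add (hI 1 1) (hI 1 (-1)),
    integral_const_mul, integral_const_mul, hE, hE, hE, hE]
  simp only [Real.coe_toNNReal']
  have hm : ∀ x : ℝ, max x 0 ^ 2 ≤ x ^ 2 := fun x => by
    rcases le_total x 0 with hx | hx
    · rw [max_eq_right hx, zero_pow two_ne_zero]; positivity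
    · rw [max_eq_left hx]
  have a1 := hm (1 ^ 2 * v + 2 * 1 * 1 * c + 1 ^ 2 * v)
  have a2 := hm (1 ^ 2 * v + 2 * 1 * (-1) * c + (-1) ^ 2 * v)
  rw [max_eq_left (by linarith : 0 ≤ 1 ^ 2 * v + 2 * 1 * 0 * c + 0 ^ 2 * v),
    max_eq_left (by linarith : 0 ≤ 0 ^ 2 * v + 2 * 0 * 1 * c + 1 ^ 2 * v)]
  generalize max (1 ^ 2 * v + 2 * 1 * 1 * c + 1 ^ 2 * v) 0 = m₁ at a1 ⊢
  generalize max (1 ^ 2 * v + 2 * 1 * (-1) * c + (-1) ^ 2 * v) 0 = m₂ at a2 ⊢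
  linarith

lemma integral_sq_sum_sq_sub_le [IsProbabilityMeasure P] {κ : Type*} (s : Finset κ)
    {Z : κ → Ω → ℝ} {v : ℝ} {c : κ → κ → ℝ} (hv : 0 ≤ v)
    (h : ∀ j ∈ s, ∀ k ∈ s, ∀ x y : ℝ, P.map (fun ω => x * Z j ω + y * Z k ω) =
      gaussianReal 0 (Real.toNNReal (x ^ 2 * v + 2 * x * y * c j k + y ^ 2 * v))) :
    Integrable (fun ω => (∑ k ∈ s, (Z k ω ^ 2 - v)) ^ 2) P ∧
      ∫ ω, (∑ k ∈ s, (Z k ω ^ 2 - v)) ^ 2 ∂P ≤ ∑ j ∈ s, ∑ k ∈ s, 2 * c j k ^ 2 := by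
  have hlaw : ∀ k ∈ s, P.map (Z k) = gaussianReal 0 (Real.toNNReal v) := fun k hk => by
    simpa using h k hk k hk 1 0
  have hI1 : ∀ k ∈ s, Integrable (fun ω => Z k ω ^ 2) P := fun k hk =>
    integrable_pow_of_map_gaussianReal (hlaw k hk) 2
  have hE1 : ∀ k ∈ s, ∫ ω, Z k ω ^ 2 ∂P = v := fun k hk => by
    rw [integral_pow_of_map_gaussianReal (hlaw k hk), integral_sq_gaussianReal]
    simp [hv]
  have hpair : ∀ j ∈ s, ∀ k ∈ s, Integrable (fun ω => (Z j ω ^ 2 - v) * (Z k ω ^ 2 - v)) P ∧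
      ∫ ω, (Z j ω ^ 2 - v) * (Z k ω ^ 2 - v) ∂P ≤ 2 * c j k ^ 2 := by
    intro j hj k hk
    obtain ⟨h1, h2⟩ := integral_sq_mul_sq_le hv (h j hj k hk)
    have heq : (fun ω => (Z j ω ^ 2 - v) * (Z k ω ^ 2 - v)) = fun ω =>
        Z j ω ^ 2 * Z k ω ^ 2 - v * Z j ω ^ 2 - v * Z k ω ^ 2 + v ^ 2 := by
      funext ω; ring
    rw [heq]
    have i1 : Integrable (fun ω => Z j ω ^ 2 * Z k ω ^ 2 - v * Z j ω ^ 2) P :=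
      h1.sub ((hI1 j hj).const_mul v)
    have i2 : Integrable (fun ω => Z j ω ^ 2 * Z k ω ^ 2 - v * Z j ω ^ 2 - v * Z k ω ^ 2) P :=
      i1.sub ((hI1 k hk).const_mul v)
    refine ⟨i2.add (integrable_const _), ?_⟩
    rw [integral_add i2 (integrable_const _), integral_sub i1 ((hI1 k hk).const_mul v),
      integral_sub h1 ((hI1 j hj).const_mul v), integral_const_mul, integral_const_mul,
      hE1 j hj, hE1 k hk]
    simp
    linarith
  have heq : (fun ω => (∑ k ∈ s, (Z k ω ^ 2 - v)) ^ 2) = fun ω =>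
      ∑ j ∈ s, ∑ k ∈ s, (Z j ω ^ 2 - v) * (Z k ω ^ 2 - v) := by
    funext ω
    rw [sq, Finset.sum_mul_sum]
  rw [heq]
  refine ⟨integrable_finsetSum _ fun j hj => integrable_finsetSum _ fun k hk =>
    (hpair j hj k hk).1, ?_⟩
  rw [integral_finsetSum _ fun j hj => integrable_finsetSum _ fun k hk => (hpair j hj k hk).1]
  refine Finset.sum_le_sum fun j hj => ?_
  rw [integral_finsetSum _ fun k hk => (hpair j hj k hk).1]
  exact Finset.sum_le_sum fun k hk => (hpair j hj k hk).2

end GaussianVariables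

lemma sum_sum_sq_sub_le_tsum {φ : ℤ → ℝ} (hφ : Summable fun d => φ d ^ 2) (b M : ℕ) :
    ∑ j ∈ Finset.Ico b (b + M), ∑ k ∈ Finset.Ico b (b + M), φ ((j : ℤ) - (k : ℤ)) ^ 2 ≤
      M * ∑' d, φ d ^ 2 := by
  calc _ ≤ ∑ j ∈ Finset.Ico b (b + M), ∑' d, φ d ^ 2 := by
        refine Finset.sum_le_sum fun j _ => ?_
        have hinj : Function.Injective fun k : ℕ => (j : ℤ) - (k : ℤ) := fun x y hxy => by
          simpa using hxy
        rw [← Finset.sum_image (s := Finset.Ico b (b + M)) (f := fun d : ℤ => φ d ^ 2)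
          (g := fun k : ℕ => (j : ℤ) - (k : ℤ)) hinj.injOn]
        exact hφ.sum_le_tsum _ fun d _ => sq_nonneg _
    _ = _ := by simp

/-! ### Faber–Schauder differences of integrated fractional Brownian motion -/

section FBM

variable {Ω : Type*} [MeasurableSpace Ω] {P : Measure Ω} {H : ℝ} {W : ℝ → Ω → ℝ}

lemma IsFBM.map_sum_fsDiff [IsProbabilityMeasure P] (hH : 0 < H) (hW : IsFBM P H W) {δ : ℝ}
    (hδ : 0 ≤ δ) {ι : Type*} [Fintype ι] (u : ι → ℝ) (k : ι → ℕ)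
    (hk : ∀ i, 4 * ((k i : ℝ) + 1) * δ ≤ 1) :
    P.map (fun ω => ∑ i, u i * fsDiff (fun t => ∫ s in (0 : ℝ)..t, W s ω) (4 * k i * δ) δ) =
      gaussianReal 0 (Real.toNNReal (∑ i, ∑ j, u i * u j *
        (δ ^ (2 * H + 2) * fsCov H (4 * ((k i : ℤ) - (k j : ℤ) : ℤ))))) := by
  have hnode : ∀ a, 0 ≤ fsNode a ∧ fsNode a ≤ 4 := by
    intro a; fin_cases a <;> norm_num [fsNode]
  have h := hW.map_sum_integral hH (ι := ι × Fin 4)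
    (fun p => 4 * k p.1 * δ + fsNode p.2 * δ) (fun p => u p.1 * fsWeight p.2) (fun p => by
      refine ⟨add_nonneg (by positivity) (mul_nonneg (hnode _).1 hδ), ?_⟩
      have := mul_le_mul_of_nonneg_right (hnode p.2).2 hδ
      linarith [hk p.1])
  convert h using 2
  · funext ω
    rw [Fintype.sum_prod_type]
    refine Finset.sum_congr rfl fun i _ => ?_
    rw [← sum_fsWeight_eq_fsDiff, Finset.mul_sum]
    exact Finset.sum_congr rfl fun a _ => by ring
  · congr 1
    simp_rw [Fintype.sum_prod_type, ← sum_fsWeight_intCov_dyadic hH hδ, Finset.mul_sum]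
    refine Finset.sum_congr rfl fun i _ => ?_
    rw [Finset.sum_comm]
    refine Finset.sum_congr rfl fun a _ => Finset.sum_congr rfl fun j _ =>
      Finset.sum_congr rfl fun b _ => by ring

/-- Quadratic variations of Faber–Schauder differences concentrate on blocks. -/
lemma IsFBM.exists_integral_block_sq_le [IsProbabilityMeasure P] (hH : H ∈ Ioo (0 : ℝ) 1)
    (hW : IsFBM P H W) : ∃ K : ℝ, 0 ≤ K ∧ ∀ (δ : ℝ) (b M : ℕ), 0 < δ → 4 * ((b : ℝ) + M) * δ ≤ 1 →
      Integrable (fun ω => (∑ k ∈ Finset.Ico b (b + M),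
        (fsDiff (fun t => ∫ s in (0 : ℝ)..t, W s ω) (4 * k * δ) δ ^ 2 /
          (δ ^ (2 * H + 2) * fsCov H 0) - 1)) ^ 2) P ∧
      ∫ ω, (∑ k ∈ Finset.Ico b (b + M),
        (fsDiff (fun t => ∫ s in (0 : ℝ)..t, W s ω) (4 * k * δ) δ ^ 2 /
          (δ ^ (2 * H + 2) * fsCov H 0) - 1)) ^ 2 ∂P ≤ K * M := by
  have hv0 := fsCov_zero_pos hH
  refine ⟨2 / fsCov H 0 ^ 2 * ∑' d : ℤ, fsCov H (4 * d) ^ 2, ?_, fun δ b M hδ hbM => ?_⟩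
  · exact mul_nonneg (by positivity) (tsum_nonneg fun d => sq_nonneg _)
  set v := δ ^ (2 * H + 2) * fsCov H 0 with hv
  have hvpos : 0 < v := by positivity
  set Λ : ℕ → Ω → ℝ := fun k ω => fsDiff (fun t => ∫ s in (0 : ℝ)..t, W s ω) (4 * k * δ) δ
  obtain ⟨h1, h2⟩ := integral_sq_sum_sq_sub_le (P := P) (Finset.Ico b (b + M)) (Z := Λ) (v := v)
    (c := fun j k => δ ^ (2 * H + 2) * fsCov H (4 * ((j : ℤ) - (k : ℤ) : ℤ))) hvpos.le (by
      intro j hj k hk x y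
      have hle : ∀ i ∈ Finset.Ico b (b + M), 4 * ((i : ℝ) + 1) * δ ≤ 1 := by
        intro i hi
        rw [Finset.mem_Ico] at hi
        have : (i : ℝ) + 1 ≤ b + M := by exact_mod_cast hi.2
        refine le_trans ?_ hbM
        gcongr
      have := hW.map_sum_fsDiff hH.1 hδ.le (ι := Fin 2) ![x, y] ![j, k] (by
        intro i; fin_cases i
        · exact hle j hj
        · exact hle k hk)
      simp only [Fin.sum_univ_two, Matrix.cons_val_zero, Matrix.cons_val_one] at this
      convert this using 3
      have hsym : fsCov H (4 * ((k : ℤ) - (j : ℤ) : ℤ)) =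
          fsCov H (4 * ((j : ℤ) - (k : ℤ) : ℤ)) := by
        rw [← fsCov_neg]; congr 1; push_cast; ring
      rw [hsym, hv]
      simp
      ring)
  have heq : (fun ω => (∑ k ∈ Finset.Ico b (b + M), (Λ k ω ^ 2 / v - 1)) ^ 2) =
      fun ω => (1 / v ^ 2) * (∑ k ∈ Finset.Ico b (b + M), (Λ k ω ^ 2 - v)) ^ 2 := by
    funext ω
    have : ∀ k, Λ k ω ^ 2 / v - 1 = (1 / v) * (Λ k ω ^ 2 - v) := fun k => by field_simp
    simp_rw [this, ← Finset.mul_sum]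
    ring
  change Integrable (fun ω => (∑ k ∈ Finset.Ico b (b + M), (Λ k ω ^ 2 / v - 1)) ^ 2) P ∧
    ∫ ω, (fun ω => (∑ k ∈ Finset.Ico b (b + M), (Λ k ω ^ 2 / v - 1)) ^ 2) ω ∂P ≤ _
  rw [heq]
  refine ⟨h1.const_mul _, ?_⟩
  rw [integral_const_mul]
  have h3 := sum_sum_sq_sub_le_tsum (summable_fsCov_sq hH) b M
  calc _ ≤ 1 / v ^ 2 * ∑ j ∈ Finset.Ico b (b + M), ∑ k ∈ Finset.Ico b (b + M),
        2 * (δ ^ (2 * H + 2) * fsCov H (4 * ((j : ℤ) - (k : ℤ) : ℤ))) ^ 2 := by gcongr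
    _ = 2 / fsCov H 0 ^ 2 * ∑ j ∈ Finset.Ico b (b + M), ∑ k ∈ Finset.Ico b (b + M),
        fsCov H (4 * ((j : ℤ) - (k : ℤ) : ℤ)) ^ 2 := by
      simp_rw [Finset.mul_sum]
      refine Finset.sum_congr rfl fun j _ => Finset.sum_congr rfl fun k _ => ?_
      have : δ ^ (2 * H + 2) ≠ 0 := by positivity
      rw [hv]
      field_simp
    _ ≤ 2 / fsCov H 0 ^ 2 * (M * ∑' d : ℤ, fsCov H (4 * d) ^ 2) := by gcongr
    _ = _ := by ring

/-- Even moments of the increments of fractional Brownian motion. -/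
lemma IsFBM.integral_increment_pow (hH : 0 < H) (hW : IsFBM P H W) {s t : ℝ}
    (hs : s ∈ Icc (0 : ℝ) 1) (ht : t ∈ Icc (0 : ℝ) 1) (p : ℕ) :
    Integrable (fun ω => (W t ω - W s ω) ^ (2 * p)) P ∧
      ∫ ω, (W t ω - W s ω) ^ (2 * p) ∂P =
        (|t - s| ^ (2 * H)) ^ p * ∫ x, x ^ (2 * p) ∂(gaussianReal 0 1) := by
  have h := hW.map_sum (ι := Fin 2) ![t, s] ![1, -1] (by
    intro i; fin_cases i
    · exact ht
    · exact hs)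
  have h' : P.map (fun ω => W t ω - W s ω) =
      gaussianReal 0 (Real.toNNReal (|t - s| ^ (2 * H))) := by
    convert h using 2
    · funext ω
      simp [Fin.sum_univ_two]
      ring
    · congr 1
      simp only [Fin.sum_univ_two, fbmCov, Matrix.cons_val_zero, Matrix.cons_val_one]
      rw [abs_sub_comm s t]
      simp [Real.zero_rpow (by positivity : 2 * H ≠ 0)]
      ring
  refine ⟨integrable_pow_of_map_gaussianReal h' _, ?_⟩
  rw [integral_pow_of_map_gaussianReal h', integral_pow_even_gaussianReal,
    Real.coe_toNNReal _ (by positivity)]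

/-- A sequence of nonnegative random variables with geometrically decaying
expectations is almost surely bounded. -/
lemma ae_exists_forall_le_of_integral_le_geometric {Z : ℕ → Ω → ℝ} {C ρ : ℝ} (hρ0 : 0 ≤ ρ)
    (hρ : ρ < 1) (h0 : ∀ n ω, 0 ≤ Z n ω) (hi : ∀ n, Integrable (Z n) P)
    (hZ : ∀ n, ∫ ω, Z n ω ∂P ≤ C * ρ ^ n) : ∀ᵐ ω ∂P, ∃ K, 0 ≤ K ∧ ∀ n, Z n ω ≤ K := by
  have hm : ∀ n, AEMeasurable (fun ω => ENNReal.ofReal (Z n ω)) P := fun n =>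
    (hi n).aestronglyMeasurable.aemeasurable.ennreal_ofReal
  have hsum : ∫⁻ ω, ∑' n, ENNReal.ofReal (Z n ω) ∂P ≠ ⊤ := by
    rw [lintegral_tsum hm]
    have h1 : ∀ n, ∫⁻ ω, ENNReal.ofReal (Z n ω) ∂P ≤ ENNReal.ofReal (C * ρ ^ n) := fun n => by
      rw [← ofReal_integral_eq_lintegral_ofReal (hi n) (Eventually.of_forall (h0 n))]
      exact ENNReal.ofReal_le_ofReal (hZ n)
    have hs : Summable fun n => C * ρ ^ n := (summable_geometric_of_lt_one hρ0 hρ).mul_left C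
    exact ((ENNReal.tsum_le_tsum h1).trans_lt hs.tsum_ofReal_lt_top).ne
  filter_upwards [ae_lt_top' (AEMeasurable.tsum hm) hsum] with ω hω
  refine ⟨(∑' n, ENNReal.ofReal (Z n ω)).toReal, ENNReal.toReal_nonneg, fun n => ?_⟩
  rw [← ENNReal.toReal_ofReal (h0 n ω)]
  exact ENNReal.toReal_mono hω.ne (ENNReal.le_tsum n)

end FBM

/-! ### Almost sure path properties -/

lemma abs_sub_le_of_dyadic_increments {w : ℝ → ℝ} {C q : ℝ} (hw : ContinuousOn w (Icc 0 1))
    (hC : 0 ≤ C) (hq0 : 0 ≤ q) (hq1 : q < 1)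
    (h : ∀ n k : ℕ, k < 2 ^ n → |w ((k + 1 : ℝ) / 2 ^ n) - w ((k : ℝ) / 2 ^ n)| ≤ C * q ^ n)
    {n k : ℕ} (hk : k < 2 ^ n) {s : ℝ} (hs : s ∈ Icc ((k : ℝ) / 2 ^ n) ((k + 1 : ℝ) / 2 ^ n)) :
    |w s - w ((k : ℝ) / 2 ^ n)| ≤ C / (1 - q) * q ^ n := by
  have hq : 0 < 1 - q := by linarith
  have hCle : C ≤ C / (1 - q) := le_div_self hC hq (by linarith)
  rcases hs.2.eq_or_lt with heq | hlt
  · rw [heq]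
    exact (h n k hk).trans (by gcongr)
  have hs0 : 0 ≤ s := le_trans (by positivity) hs.1
  have hk1 : (k : ℝ) + 1 ≤ 2 ^ n := by exact_mod_cast hk
  have hs1 : s < 1 := hlt.trans_le ((div_le_one (by positivity)).2 hk1)
  set φ : ℕ → ℕ := fun N => ⌊s * 2 ^ N⌋₊ with hφ
  have hφn : φ n = k := by
    rw [hφ, Nat.floor_eq_iff (by positivity)]
    constructor
    · rw [← div_le_iff₀ (by positivity)]; exact hs.1
    · rw [← lt_div_iff₀ (by positivity)]; exact hlt
  have hφle : ∀ N, (φ N : ℝ) ≤ s * 2 ^ N := fun N => Nat.floor_le (by positivity)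
  have hφlt : ∀ N, s * 2 ^ N < φ N + 1 := fun N => Nat.lt_floor_add_one _
  have hφpow : ∀ N, φ N < 2 ^ N := fun N => by
    have : (φ N : ℝ) < 2 ^ N := (hφle N).trans_lt (by
      have : (0 : ℝ) < 2 ^ N := by positivity
      nlinarith)
    exact_mod_cast this
  have hstep : ∀ N, |w ((φ (N + 1) : ℝ) / 2 ^ (N + 1)) - w ((φ N : ℝ) / 2 ^ N)| ≤
      C * q ^ (N + 1) := by
    intro N
    have e : ((2 * φ N : ℕ) : ℝ) / 2 ^ (N + 1) = (φ N : ℝ) / 2 ^ N := by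
      push_cast; rw [pow_succ]; field_simp
    have hlt2 : (φ (N + 1) : ℝ) < 2 * φ N + 2 := by
      have a1 := hφle (N + 1)
      have a2 := hφlt N
      rw [pow_succ] at a1
      linarith
    have hle2 : (2 * φ N : ℝ) < φ (N + 1) + 1 := by
      have a1 := hφlt (N + 1)
      have a2 := hφle N
      rw [pow_succ] at a1
      linarith
    have h1 : φ (N + 1) < 2 * φ N + 2 := by exact_mod_cast hlt2
    have h2 : 2 * φ N < φ (N + 1) + 1 := by exact_mod_cast hle2
    rw [← e]
    rcases (by omega : φ (N + 1) = 2 * φ N ∨ φ (N + 1) = 2 * φ N + 1) with h3 | h3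
    · rw [h3, sub_self, abs_zero]; positivity
    · have := h (N + 1) (2 * φ N) (by have := hφpow (N + 1); omega)
      rw [h3]
      push_cast at this ⊢
      exact this
  have hind : ∀ j, |w ((φ (n + j) : ℝ) / 2 ^ (n + j)) - w ((k : ℝ) / 2 ^ n)| ≤
      C / (1 - q) * (q ^ n - q ^ (n + j)) := by
    intro j
    induction j with
    | zero => simp [hφn]
    | succ j ih =>
      have hst := hstep (n + j)
      have hle : C * q ^ (n + j + 1) ≤ C / (1 - q) * (q ^ (n + j) - q ^ (n + j + 1)) := by
        have : C / (1 - q) * (q ^ (n + j) - q ^ (n + j + 1)) = C * q ^ (n + j) := by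
          rw [pow_succ]; field_simp
        rw [this]
        exact mul_le_mul_of_nonneg_left (pow_le_pow_of_le_one hq0 hq1.le (by omega)) hC
      rw [← add_assoc]
      calc _ ≤ |w ((φ (n + j + 1) : ℝ) / 2 ^ (n + j + 1)) - w ((φ (n + j) : ℝ) / 2 ^ (n + j))| +
            |w ((φ (n + j) : ℝ) / 2 ^ (n + j)) - w ((k : ℝ) / 2 ^ n)| := abs_sub_le _ _ _
        _ ≤ C / (1 - q) * (q ^ (n + j) - q ^ (n + j + 1)) +
            C / (1 - q) * (q ^ n - q ^ (n + j)) := add_le_add (hst.trans hle) ih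
        _ = _ := by ring
  have hlim : Tendsto (fun j : ℕ => (φ (n + j) : ℝ) / 2 ^ (n + j)) atTop (𝓝[Icc 0 1] s) := by
    refine tendsto_nhdsWithin_iff.2 ⟨?_, Eventually.of_forall fun j => ⟨by positivity, ?_⟩⟩
    · have h2 : Tendsto (fun j : ℕ => (2 : ℝ) ^ (n + j)) atTop atTop :=
        (tendsto_pow_atTop_atTop_of_one_lt one_lt_two).comp
          (tendsto_add_atTop_nat n |>.congr fun j => add_comm _ _)
      exact (tendsto_nat_floor_mul_div_atTop hs0).comp h2
    · exact (div_le_one (by positivity)).2 (by exact_mod_cast (hφpow (n + j)).le)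
  have hws := (hw s ⟨hs0, hs1.le⟩).tendsto.comp hlim
  refine le_of_tendsto ((hws.sub_const _).abs) (Eventually.of_forall fun j => (hind j).trans ?_)
  have : 0 ≤ q ^ (n + j) := by positivity
  have : 0 ≤ C / (1 - q) := by positivity
  nlinarith

section FBM

variable {Ω : Type*} [MeasurableSpace Ω] {P : Measure Ω} {H : ℝ} {W : ℝ → Ω → ℝ}

/-- Paths of fractional Brownian motion are Hölder continuous on dyadic intervals. -/
lemma IsFBM.ae_exists_abs_sub_le (hH : 0 < H) (hW : IsFBM P H W) {β : ℝ} (hβ0 : 0 < β)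
    (hβ : β < H) : ∀ᵐ ω ∂P, ∃ C : ℝ, 0 ≤ C ∧ ∀ n k : ℕ, k < 2 ^ n →
      ∀ s ∈ Icc ((k : ℝ) / 2 ^ n) ((k + 1 : ℝ) / 2 ^ n),
        |W s ω - W ((k : ℝ) / 2 ^ n) ω| ≤ C * ((2 : ℝ) ^ (-β)) ^ n := by
  obtain ⟨p, hp⟩ := exists_nat_gt (1 / (2 * (H - β)))
  have hHβ : 0 < H - β := sub_pos.2 hβ
  have hp1 : 1 < 2 * p * (H - β) := by
    rw [div_lt_iff₀ (by positivity)] at hp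
    linarith
  have hp0 : p ≠ 0 := by
    rintro rfl; norm_num at hp1
  set q : ℝ := (2 : ℝ) ^ (-β) with hq
  have hqpos : 0 < q := by positivity
  have hq1 : q < 1 := Real.rpow_lt_one_of_one_lt_of_neg one_lt_two (by linarith)
  have hmem : ∀ n k : ℕ, k < 2 ^ n → (k : ℝ) / 2 ^ n ∈ Icc (0 : ℝ) 1 ∧
      (k + 1 : ℝ) / 2 ^ n ∈ Icc (0 : ℝ) 1 := fun n k hk => by
    have : (k : ℝ) + 1 ≤ 2 ^ n := by exact_mod_cast hk
    exact ⟨⟨by positivity, (div_le_one (by positivity)).2 (by linarith)⟩,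
      ⟨by positivity, (div_le_one (by positivity)).2 this⟩⟩
  have hmom := fun n k (hk : k < 2 ^ n) =>
    hW.integral_increment_pow hH (hmem n k hk).1 (hmem n k hk).2 p
  set c := ∫ x, x ^ (2 * p) ∂(gaussianReal 0 1) with hc
  have hae := ae_exists_forall_le_of_integral_le_geometric (P := P)
    (Z := fun n ω => ∑ k ∈ Finset.range (2 ^ n), (1 / (q ^ n)) ^ (2 * p) *
      (W ((k + 1 : ℝ) / 2 ^ n) ω - W ((k : ℝ) / 2 ^ n) ω) ^ (2 * p))
    (C := c) (ρ := (2 : ℝ) ^ (1 - 2 * p * (H - β))) (by positivity)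
    (Real.rpow_lt_one_of_one_lt_of_neg one_lt_two (by linarith))
    (fun n ω => Finset.sum_nonneg fun k _ => mul_nonneg (by positivity)
      ((even_two_mul p).pow_nonneg _))
    (fun n => integrable_finsetSum _ fun k hk =>
      (hmom n k (Finset.mem_range.1 hk)).1.const_mul _)
    (fun n => by
      rw [integral_finsetSum _ fun k hk => (hmom n k (Finset.mem_range.1 hk)).1.const_mul _]
      have : ∀ k ∈ Finset.range (2 ^ n), ∫ ω, (1 / (q ^ n)) ^ (2 * p) *
          (W ((k + 1 : ℝ) / 2 ^ n) ω - W ((k : ℝ) / 2 ^ n) ω) ^ (2 * p) ∂P =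
          (1 / (q ^ n)) ^ (2 * p) * ((((1 : ℝ) / 2 ^ n) ^ (2 * H)) ^ p * c) := by
        intro k hk
        rw [integral_const_mul, (hmom n k (Finset.mem_range.1 hk)).2,
          show (k + 1 : ℝ) / 2 ^ n - k / 2 ^ n = 1 / 2 ^ n by ring, abs_of_pos (by positivity)]
      rw [Finset.sum_congr rfl this, Finset.sum_const, Finset.card_range, nsmul_eq_mul]
      apply le_of_eq
      have h2 : (0 : ℝ) ≤ 2 := zero_le_two
      have h2' : (0 : ℝ) < 2 := zero_lt_two
      push_cast
      simp only [hq, one_div, ← Real.rpow_natCast, ← Real.rpow_mul h2, ← Real.rpow_neg h2]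
      rw [mul_comm c, ← mul_assoc, ← mul_assoc, ← Real.rpow_add h2', ← Real.rpow_add h2']
      congr 2
      push_cast
      ring)
  filter_upwards [hae, hW.2.1] with ω hω hcont
  obtain ⟨K, hK, hKn⟩ := hω
  refine ⟨(K + 1) / (1 - q), div_nonneg (by linarith) (by linarith), fun n k hk s hs =>
    abs_sub_le_of_dyadic_increments (w := fun t => W t ω) hcont (by linarith) hqpos.le hq1
      (fun n k hk => ?_) hk hs⟩
  have h1 := (Finset.single_le_sum (f := fun k : ℕ => (1 / (q ^ n)) ^ (2 * p) *
      (W ((k + 1 : ℝ) / 2 ^ n) ω - W ((k : ℝ) / 2 ^ n) ω) ^ (2 * p))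
    (fun k _ => mul_nonneg (by positivity) ((even_two_mul p).pow_nonneg _))
    (Finset.mem_range.2 hk)).trans (hKn n)
  simp only [← mul_pow] at h1
  by_contra! hcon
  set y := |W ((k + 1 : ℝ) / 2 ^ n) ω - W ((k : ℝ) / 2 ^ n) ω| with hy
  have hy1 : K + 1 < 1 / q ^ n * y := by
    rw [one_div, ← div_eq_inv_mul, lt_div_iff₀ (by positivity)]
    exact hcon
  have h3 : (1 / q ^ n * y) ^ (2 * p) ≤ K := by
    rw [hy, ← abs_of_pos (by positivity : 0 < 1 / q ^ n), ← abs_mul, (even_two_mul p).pow_abs]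
    exact h1
  have h4 := le_self_pow₀ (by linarith : 1 ≤ 1 / q ^ n * y) (by omega : 2 * p ≠ 0)
  linarith

/-- Almost sure control of the fluctuations of quadratic variations over blocks. -/
lemma IsFBM.ae_exists_sum_block_le [IsProbabilityMeasure P] (hH : H ∈ Ioo (0 : ℝ) 1)
    (hW : IsFBM P H W) {l : ℕ → ℕ} {θ κ : ℝ} (hl : ∀ n, l n ≤ n) (hlθ : ∀ n, (l n : ℝ) ≤ θ * n)
    (hκ : 2 * κ < 1 - θ) :
    ∀ᵐ ω ∂P, ∃ C : ℝ, 0 ≤ C ∧ ∀ n : ℕ, ∑ b ∈ Finset.range (2 ^ l n),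
      |∑ k ∈ Finset.Ico (b * 2 ^ (n - l n)) (b * 2 ^ (n - l n) + 2 ^ (n - l n)),
        (fsDiff (fun t => ∫ s in (0 : ℝ)..t, W s ω) (4 * k * (1 / 2 ^ (n + 2))) (1 / 2 ^ (n + 2)) ^ 2
          / ((1 / 2 ^ (n + 2)) ^ (2 * H + 2) * fsCov H 0) - 1)| ≤
      C * (2 ^ n * ((2 : ℝ) ^ (-κ)) ^ n) := by
  obtain ⟨K, hK, h⟩ := hW.exists_integral_block_sq_le hH
  set Q : ℕ → ℕ → Ω → ℝ := fun n b ω =>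
    ∑ k ∈ Finset.Ico (b * 2 ^ (n - l n)) (b * 2 ^ (n - l n) + 2 ^ (n - l n)),
        (fsDiff (fun t => ∫ s in (0 : ℝ)..t, W s ω) (4 * k * (1 / 2 ^ (n + 2))) (1 / 2 ^ (n + 2)) ^ 2
          / ((1 / 2 ^ (n + 2)) ^ (2 * H + 2) * fsCov H 0) - 1) with hQ
  set q : ℝ := (2 : ℝ) ^ (-κ) with hq
  have hqpos : 0 < q := by positivity
  have hsplit : ∀ n, (2 : ℝ) ^ l n * 2 ^ (n - l n) = 2 ^ n := fun n => by
    rw [← pow_add, Nat.add_sub_cancel' (hl n)]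
  have hQi : ∀ n, ∀ b < 2 ^ l n, Integrable (fun ω => Q n b ω ^ 2) P ∧
      ∫ ω, Q n b ω ^ 2 ∂P ≤ K * 2 ^ (n - l n) := by
    intro n b hb
    have := h (1 / 2 ^ (n + 2)) (b * 2 ^ (n - l n)) (2 ^ (n - l n)) (by positivity) (by
      have hb' : (b : ℝ) + 1 ≤ 2 ^ l n := by exact_mod_cast hb
      push_cast
      have h1 : ((b : ℝ) + 1) * 2 ^ (n - l n) ≤ 2 ^ n := by
        rw [← hsplit n]; gcongr
      have h2 : (2 : ℝ) ^ (n + 2) = 4 * 2 ^ n := by ring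
      rw [h2, mul_one_div, div_le_one (by positivity)]
      linarith)
    simpa [hQ] using this
  have hae := ae_exists_forall_le_of_integral_le_geometric (P := P)
    (Z := fun n ω => ∑ b ∈ Finset.range (2 ^ l n),
      2 ^ l n / (2 ^ n * q ^ n) ^ 2 * Q n b ω ^ 2)
    (C := K) (ρ := (2 : ℝ) ^ (2 * κ - (1 - θ))) (by positivity)
    (Real.rpow_lt_one_of_one_lt_of_neg one_lt_two (by linarith))
    (fun n ω => Finset.sum_nonneg fun k _ => by positivity)
    (fun n => integrable_finsetSum _ fun b hb =>
      (hQi n b (Finset.mem_range.1 hb)).1.const_mul _)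
    (fun n => by
      rw [integral_finsetSum _ fun b hb => (hQi n b (Finset.mem_range.1 hb)).1.const_mul _]
      have h1 : ∀ b ∈ Finset.range (2 ^ l n),
          ∫ ω, 2 ^ l n / (2 ^ n * q ^ n) ^ 2 * Q n b ω ^ 2 ∂P ≤
          2 ^ l n / (2 ^ n * q ^ n) ^ 2 * (K * 2 ^ (n - l n)) := by
        intro b hb
        rw [integral_const_mul]
        have := (hQi n b (Finset.mem_range.1 hb)).2
        gcongr
      refine (Finset.sum_le_sum h1).trans ?_
      rw [Finset.sum_const, Finset.card_range, nsmul_eq_mul]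
      push_cast
      have e1 : (2 : ℝ) ^ l n * (2 ^ l n / (2 ^ n * q ^ n) ^ 2 * (K * 2 ^ (n - l n))) =
          K * (2 ^ l n / (2 ^ n * (q ^ n) ^ 2)) := by
        rw [← hsplit n]; field_simp
      rw [e1]
      gcongr
      have h2 : (0 : ℝ) ≤ 2 := zero_le_two
      have h2' : (0 : ℝ) < 2 := zero_lt_two
      simp only [hq, div_eq_mul_inv, ← Real.rpow_natCast, ← Real.rpow_mul h2,
        ← Real.rpow_neg h2, ← Real.rpow_add h2']
      apply Real.rpow_le_rpow_of_exponent_le one_le_two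
      push_cast
      linarith [hlθ n])
  filter_upwards [hae] with ω hω
  obtain ⟨K', hK', hKn⟩ := hω
  refine ⟨K' + 1, by linarith, fun n => ?_⟩
  have h1 := hKn n
  rw [← Finset.mul_sum] at h1
  have hcs := sq_sum_le_card_mul_sum_sq (s := Finset.range (2 ^ l n)) (f := fun b => |Q n b ω|)
  simp only [sq_abs, Finset.card_range] at hcs
  push_cast at hcs
  set D : ℝ := 2 ^ n * q ^ n with hD
  have hDpos : 0 < D := by positivity
  have h2 : (∑ b ∈ Finset.range (2 ^ l n), |Q n b ω|) ^ 2 ≤ K' * D ^ 2 := by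
    refine hcs.trans ?_
    rw [← div_le_iff₀ (by positivity)]
    refine le_trans (le_of_eq ?_) h1
    ring
  have h3 : K' * D ^ 2 ≤ ((K' + 1) * D) ^ 2 := by
    rw [mul_pow (K' + 1) D]
    exact mul_le_mul_of_nonneg_right (by nlinarith) (by positivity)
  exact (abs_le_of_sq_le_sq' (h2.trans h3) (by positivity)).2

end FBM

/-! ### Pathwise estimates -/

lemma sum_range_mul_eq_sum_Ico (A M : ℕ) (f : ℕ → ℝ) :
    ∑ k ∈ Finset.range (A * M), f k =
      ∑ b ∈ Finset.range A, ∑ k ∈ Finset.Ico (b * M) (b * M + M), f k := by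
  induction A with
  | zero => simp
  | succ A ih =>
    rw [Finset.sum_range_succ, ← ih, add_mul, one_mul, Finset.range_eq_Ico, Finset.range_eq_Ico,
      Finset.sum_Ico_consecutive f (Nat.zero_le _) (Nat.le_add_right _ _)]

/-- Comparison of weighted quadratic sums with their normalisation, using cancellations
within blocks of length `M`. -/
lemma abs_sum_sq_sub_le_of_block {A M : ℕ} {a ζ y : ℕ → ℝ} {B η σ ε : ℝ} (hB : 0 ≤ B)
    (hη : 0 ≤ η) (hε : 0 ≤ ε) (ha : ∀ k < A * M, |a k| ≤ B)
    (hosc : ∀ b < A, ∀ k ∈ Finset.Ico (b * M) (b * M + M), |a k ^ 2 - a (b * M) ^ 2| ≤ η)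
    (hQ : ∑ b ∈ Finset.range A, |∑ k ∈ Finset.Ico (b * M) (b * M + M), (ζ k ^ 2 - 1)| ≤
      σ * (A * M : ℕ))
    (hy : ∀ k < A * M, |y k - a k * ζ k| ≤ ε) :
    |∑ k ∈ Finset.range (A * M), (y k ^ 2 - a k ^ 2)| ≤
      (A * M : ℕ) * (B ^ 2 * σ + η * (2 + σ) + ε * (B * (2 + σ) + ε)) := by
  have hlt : ∀ b < A, ∀ k ∈ Finset.Ico (b * M) (b * M + M), k < A * M := by
    intro b hb k hk
    have h1 := (Finset.mem_Ico.1 hk).2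
    have h2 : (b + 1) * M ≤ A * M := Nat.mul_le_mul_right _ hb
    rw [add_mul, one_mul] at h2
    omega
  set N := A * M with hN
  have hζ : ∑ k ∈ Finset.range N, ζ k ^ 2 ≤ N * (1 + σ) := by
    have h1 : ∑ k ∈ Finset.range N, (ζ k ^ 2 - 1) ≤ σ * N := by
      rw [hN, sum_range_mul_eq_sum_Ico]
      exact (Finset.sum_le_sum fun b _ => le_abs_self _).trans hQ
    rw [Finset.sum_sub_distrib] at h1
    simp only [Finset.sum_const, Finset.card_range, nsmul_eq_mul, mul_one] at h1
    linarith
  have habs : ∑ k ∈ Finset.range N, |ζ k ^ 2 - 1| ≤ N * (2 + σ) := by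
    calc _ ≤ ∑ k ∈ Finset.range N, (ζ k ^ 2 + 1) := Finset.sum_le_sum fun k _ => by
          rw [abs_le]; constructor <;> nlinarith [sq_nonneg (ζ k)]
      _ ≤ _ := by
          rw [Finset.sum_add_distrib]
          simp only [Finset.sum_const, Finset.card_range, nsmul_eq_mul, mul_one]
          linarith
  have h1 : |∑ k ∈ Finset.range N, (y k ^ 2 - a k ^ 2 * ζ k ^ 2)| ≤
      N * (ε * (B * (2 + σ) + ε)) := by
    calc _ ≤ ∑ k ∈ Finset.range N, |y k ^ 2 - a k ^ 2 * ζ k ^ 2| := Finset.abs_sum_le_sum_abs _ _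
      _ ≤ ∑ k ∈ Finset.range N, ε * (B * (1 + ζ k ^ 2) + ε) := by
          refine Finset.sum_le_sum fun k hk => ?_
          have hk' := Finset.mem_range.1 hk
          have e1 : y k ^ 2 - a k ^ 2 * ζ k ^ 2 =
              (y k - a k * ζ k) * (2 * (a k * ζ k) + (y k - a k * ζ k)) := by ring
          rw [e1, abs_mul]
          have h2 : 2 * |ζ k| ≤ 1 + ζ k ^ 2 := by
            rw [← sq_abs (ζ k)]; nlinarith [sq_nonneg (|ζ k| - 1)]
          have h3 : |2 * (a k * ζ k) + (y k - a k * ζ k)| ≤ B * (1 + ζ k ^ 2) + ε := by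
            refine (abs_add_le _ _).trans (add_le_add ?_ (hy k hk'))
            rw [abs_mul, abs_mul, abs_two]
            calc 2 * (|a k| * |ζ k|) = |a k| * (2 * |ζ k|) := by ring
              _ ≤ _ := mul_le_mul (ha k hk') h2 (by positivity) hB
          exact mul_le_mul (hy k hk') h3 (abs_nonneg _) hε
      _ = ε * (B * (N + ∑ k ∈ Finset.range N, ζ k ^ 2) + N * ε) := by
          rw [← Finset.mul_sum, Finset.sum_add_distrib, ← Finset.mul_sum, Finset.sum_add_distrib]
          simp
      _ ≤ ε * (B * (N + N * (1 + σ)) + N * ε) := by gcongr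
      _ = _ := by ring
  have h2 : |∑ k ∈ Finset.range N, a k ^ 2 * (ζ k ^ 2 - 1)| ≤
      N * (B ^ 2 * σ + η * (2 + σ)) := by
    have e1 : ∑ k ∈ Finset.range N, a k ^ 2 * (ζ k ^ 2 - 1) =
        ∑ b ∈ Finset.range A, a (b * M) ^ 2 *
          ∑ k ∈ Finset.Ico (b * M) (b * M + M), (ζ k ^ 2 - 1) +
        ∑ b ∈ Finset.range A, ∑ k ∈ Finset.Ico (b * M) (b * M + M),
          (a k ^ 2 - a (b * M) ^ 2) * (ζ k ^ 2 - 1) := by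
      rw [hN, sum_range_mul_eq_sum_Ico, ← Finset.sum_add_distrib]
      refine Finset.sum_congr rfl fun b _ => ?_
      rw [Finset.mul_sum, ← Finset.sum_add_distrib]
      exact Finset.sum_congr rfl fun k _ => by ring
    rw [e1]
    refine (abs_add_le _ _).trans ?_
    have i1 : |∑ b ∈ Finset.range A, a (b * M) ^ 2 *
        ∑ k ∈ Finset.Ico (b * M) (b * M + M), (ζ k ^ 2 - 1)| ≤ B ^ 2 * (σ * N) := by
      refine (Finset.abs_sum_le_sum_abs _ _).trans (le_trans ?_
        (mul_le_mul_of_nonneg_left hQ (sq_nonneg B)))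
      rw [Finset.mul_sum]
      refine Finset.sum_le_sum fun b hb => ?_
      rw [abs_mul]
      rcases Nat.eq_zero_or_pos M with hM | hM
      · simp [hM]
      have hb' : b * M < N := hlt b (Finset.mem_range.1 hb) _
        (Finset.mem_Ico.2 ⟨le_rfl, by omega⟩)
      refine mul_le_mul_of_nonneg_right ?_ (abs_nonneg _)
      rw [abs_pow]
      exact pow_le_pow_left₀ (abs_nonneg _) (ha _ hb') 2
    have i2 : |∑ b ∈ Finset.range A, ∑ k ∈ Finset.Ico (b * M) (b * M + M),
          (a k ^ 2 - a (b * M) ^ 2) * (ζ k ^ 2 - 1)| ≤ η * (N * (2 + σ)) := by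
      refine (Finset.abs_sum_le_sum_abs _ _).trans (le_trans ?_
        (mul_le_mul_of_nonneg_left habs hη))
      rw [hN, sum_range_mul_eq_sum_Ico, Finset.mul_sum]
      refine Finset.sum_le_sum fun b hb => (Finset.abs_sum_le_sum_abs _ _).trans ?_
      rw [Finset.mul_sum]
      refine Finset.sum_le_sum fun k hk => ?_
      rw [abs_mul]
      exact mul_le_mul_of_nonneg_right (hosc b (Finset.mem_range.1 hb) k hk) (abs_nonneg _)
    linarith
  have e : ∑ k ∈ Finset.range N, (y k ^ 2 - a k ^ 2) =
      ∑ k ∈ Finset.range N, (y k ^ 2 - a k ^ 2 * ζ k ^ 2) +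
        ∑ k ∈ Finset.range N, a k ^ 2 * (ζ k ^ 2 - 1) := by
    rw [← Finset.sum_add_distrib]
    exact Finset.sum_congr rfl fun k _ => by ring
  rw [e]
  refine (abs_add_le _ _).trans ?_
  linarith

lemma abs_integral_sub_affine_le {u : ℝ → ℝ} {t h c A ε : ℝ} (hh : 0 ≤ h)
    (hu : IntervalIntegrable u volume t (t + h))
    (hε : ∀ s ∈ Icc t (t + h), |u s - c - A * (s - t)| ≤ ε) :
    |(∫ s in t..(t + h), u s) - c * h - A * h ^ 2 / 2| ≤ ε * h := by
  have h1 : (∫ s in t..(t + h), u s) - c * h - A * h ^ 2 / 2 =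
      ∫ s in t..(t + h), (u s - c - A * (s - t)) := by
    rw [intervalIntegral.integral_sub (hu.sub (by simp))
      (Continuous.intervalIntegrable (by fun_prop) _ _),
      intervalIntegral.integral_sub hu (by simp)]
    have h2 : ∫ s in t..(t + h), A * (s - t) = A * h ^ 2 / 2 := by
      rw [intervalIntegral.integral_const_mul, intervalIntegral.integral_comp_sub_right
        (fun s => s) t]
      simp
      ring
    rw [h2]
    simp
    ring
  rw [h1]
  have := intervalIntegral.norm_integral_le_of_norm_le_const (a := t) (b := t + h)
    (f := fun s => u s - c - A * (s - t)) (C := ε) (fun s hs => by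
      rw [uIoc_of_le (by linarith)] at hs
      exact hε s ⟨hs.1.le, hs.2⟩)
  simpa [abs_of_nonneg hh] using this

/-- The Faber–Schauder difference of a primitive annihilates affine integrands. -/
lemma abs_fsDiff_integral_sub_le {u v : ℝ → ℝ} {t δ r c A ε : ℝ} (ht : 0 ≤ t) (hδ : 0 ≤ δ)
    (h1 : t + 4 * δ ≤ 1) (hu : IntervalIntegrable u volume 0 1)
    (hv : IntervalIntegrable v volume 0 1)
    (hε : ∀ s ∈ Icc t (t + 4 * δ), |u s - r * v s - c - A * (s - t)| ≤ ε) :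
    |fsDiff (fun x => ∫ s in (0 : ℝ)..x, u s) t δ -
      r * fsDiff (fun x => ∫ s in (0 : ℝ)..x, v s) t δ| ≤ 12 * δ * ε := by
  set f : ℝ → ℝ := fun s => u s - r * v s with hf
  have hfi : IntervalIntegrable f volume 0 1 := hu.sub (hv.const_mul r)
  have hsub : ∀ {a b : ℝ}, a ∈ Icc (0 : ℝ) 1 → b ∈ Icc (0 : ℝ) 1 → uIcc a b ⊆ uIcc 0 1 := by
    intro a b ha hb
    rw [uIcc_of_le zero_le_one]
    exact ordConnected_Icc.uIcc_subset ha hb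
  have h0 : (0 : ℝ) ∈ Icc (0 : ℝ) 1 := by simp
  have hmem : ∀ j, 0 ≤ j → j ≤ 4 → t + j * δ ∈ Icc (0 : ℝ) 1 := fun j hj0 hj4 =>
    ⟨by positivity, by nlinarith⟩
  have ht1 : t ∈ Icc (0 : ℝ) 1 := by simpa using hmem 0 le_rfl (by norm_num)
  have hF : ∀ j, 0 ≤ j → j ≤ 4 → (∫ s in (0 : ℝ)..(t + j * δ), u s) -
      r * (∫ s in (0 : ℝ)..(t + j * δ), v s) - ((∫ s in (0 : ℝ)..t, u s) -
      r * (∫ s in (0 : ℝ)..t, v s)) = ∫ s in t..(t + j * δ), f s := by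
    intro j hj0 hj4
    have hm := hmem j hj0 hj4
    have hi : ∀ x ∈ Icc (0 : ℝ) 1, (∫ s in (0 : ℝ)..x, u s) - r * (∫ s in (0 : ℝ)..x, v s) =
        ∫ s in (0 : ℝ)..x, f s := by
      intro x hx
      rw [hf, intervalIntegral.integral_sub (hu.mono_set (hsub h0 hx))
        ((hv.const_mul r).mono_set (hsub h0 hx)), intervalIntegral.integral_const_mul]
    rw [hi _ hm, hi _ ht1, intervalIntegral.integral_interval_sub_left
      (hfi.mono_set (hsub h0 hm)) (hfi.mono_set (hsub h0 ht1))]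
  have hJ : ∀ j, 0 ≤ j → j ≤ 4 → |(∫ s in t..(t + j * δ), f s) - c * (j * δ) -
      A * (j * δ) ^ 2 / 2| ≤ ε * (j * δ) := by
    intro j hj0 hj4
    refine abs_integral_sub_affine_le (by positivity)
      (hfi.mono_set (hsub ht1 (hmem j hj0 hj4))) fun s hs => hε s ⟨hs.1, hs.2.trans ?_⟩
    gcongr
  have a1 := abs_le.1 (hJ 1 (by norm_num) (by norm_num))
  have a3 := abs_le.1 (hJ 3 (by norm_num) (by norm_num))
  have a4 := abs_le.1 (hJ 4 (by norm_num) (by norm_num))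
  rw [← hF 1 (by norm_num) (by norm_num)] at a1
  rw [← hF 3 (by norm_num) (by norm_num)] at a3
  rw [← hF 4 (by norm_num) (by norm_num)] at a4
  simp only [one_mul] at a1
  simp only [fsDiff]
  rw [abs_le]
  constructor <;> nlinarith [a1.1, a1.2, a3.1, a3.2, a4.1, a4.2]

/-! ### Energies of smooth functions of the path -/

lemma exists_taylor_bound {g : ℝ → ℝ} (hg : ContDiff ℝ 2 g) (R : ℝ) :
    ∃ B : ℝ, 0 ≤ B ∧ ∀ a ∈ Icc (-R) R, ∀ b ∈ Icc (-R) R, |deriv g a| ≤ B ∧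
      |g b - g a - deriv g a * (b - a)| ≤ B * (b - a) ^ 2 ∧
      |deriv g b - deriv g a| ≤ B * |b - a| := by
  have hg1 : ContDiff ℝ 1 (deriv g) :=
    (contDiff_succ_iff_deriv (n := 1).1 (by simpa [one_add_one_eq_two] using hg)).2.2
  have hc1 : Continuous (deriv g) := hg1.continuous
  have hd1 : Differentiable ℝ (deriv g) := hg1.differentiable (by norm_num)
  have hd0 : Differentiable ℝ g := hg.differentiable (by norm_num)
  have hc2 : Continuous (deriv (deriv g)) := hg1.continuous_deriv (by norm_num)
  obtain ⟨B₁, hB₁⟩ := isCompact_Icc.exists_bound_of_continuousOn (s := Icc (-R) R) hc1.continuousOn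
  obtain ⟨B₂, hB₂⟩ := isCompact_Icc.exists_bound_of_continuousOn (s := Icc (-R) R) hc2.continuousOn
  have hlip : ∀ a ∈ Icc (-R) R, ∀ b ∈ Icc (-R) R,
      |deriv g b - deriv g a| ≤ max 0 (max B₁ B₂) * |b - a| := by
    intro a ha b hb
    have := (convex_Icc (-R) R).norm_image_sub_le_of_norm_hasDerivWithin_le
      (f := deriv g) (f' := deriv (deriv g)) (C := max 0 (max B₁ B₂))
      (fun z _ => (hd1 z).hasDerivAt.hasDerivWithinAt)
      (fun z hz => (hB₂ z hz).trans (by simp)) ha hb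
    simpa using this
  refine ⟨max 0 (max B₁ B₂), le_max_left _ _, fun a ha b hb => ⟨?_, ?_, hlip a ha b hb⟩⟩
  · exact (hB₁ a ha).trans (by simp)
  · have hsub : uIcc a b ⊆ Icc (-R) R := ordConnected_Icc.uIcc_subset ha hb
    have := (convex_uIcc a b).norm_image_sub_le_of_norm_hasDerivWithin_le
      (f := fun z => g z - deriv g a * z) (f' := fun z => deriv g z - deriv g a)
      (C := max 0 (max B₁ B₂) * |b - a|)
      (fun z _ => by
        have h := (hd0 z).hasDerivAt.sub ((hasDerivAt_id z).const_mul (deriv g a))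
        simp only [mul_one] at h
        exact h.hasDerivWithinAt)
      (fun z hz => (hlip a ha z (hsub hz)).trans (by
        have : |z - a| ≤ |b - a| := abs_sub_left_of_mem_uIcc hz
        gcongr)) left_mem_uIcc right_mem_uIcc
    rw [Real.norm_eq_abs, Real.norm_eq_abs] at this
    rw [← sq_abs (b - a)]
    calc _ = |g b - deriv g a * b - (g a - deriv g a * a)| := by congr 1; ring
      _ ≤ _ := this
      _ = _ := by ring

lemma vartheta_eq_fsDiff (f : ℝ → ℝ) (n k : ℕ) :
    vartheta f n k = (2 : ℝ) ^ ((3 * (n : ℝ)) / 2 + 3) *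
      fsDiff f (4 * k * (1 / 2 ^ (n + 2))) (1 / 2 ^ (n + 2)) := by
  unfold vartheta fsDiff
  have e : ∀ j : ℝ, (4 * (k : ℝ) + j) / 2 ^ (n + 2) =
      4 * k * (1 / 2 ^ (n + 2)) + j * (1 / 2 ^ (n + 2)) := fun j => by ring
  rw [e 1, e 3, e 4, one_mul, mul_one_div]

lemma mul_rpow_pow_eq (H κ : ℝ) (n : ℕ) :
    (1 / 2 ^ (n + 2) : ℝ) * ((2 : ℝ) ^ (-(H + κ))) ^ n =
      2 ^ (2 * H) * ((2 : ℝ) ^ (-κ)) ^ n * (1 / 2 ^ (n + 2)) ^ (H + 1) := by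
  have h2 : (0 : ℝ) < 2 := zero_lt_two
  have e : (1 / 2 ^ (n + 2) : ℝ) = 2 ^ (-((n : ℝ) + 2)) := by
    rw [Real.rpow_neg h2.le, one_div, ← Real.rpow_natCast]; push_cast; rfl
  rw [e, ← Real.rpow_mul h2.le, ← Real.rpow_natCast, ← Real.rpow_natCast, ← Real.rpow_mul h2.le,
    ← Real.rpow_mul h2.le, ← Real.rpow_add h2, ← Real.rpow_add h2, ← Real.rpow_add h2]
  congr 1; ring

lemma scale_mul_sq_mul_eq (H : ℝ) (n : ℕ) :
    ((2 : ℝ) ^ (-(2 * (1 - H)))) ^ n * ((2 : ℝ) ^ ((3 * (n : ℝ)) / 2 + 3)) ^ 2 *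
      (1 / 2 ^ (n + 2)) ^ (2 * H + 2) = 2 ^ (2 - 4 * H) * (1 / 2 ^ n) := by
  have h2 : (0 : ℝ) < 2 := zero_lt_two
  have e : ∀ m : ℕ, (1 / 2 ^ m : ℝ) = 2 ^ (-(m : ℝ)) := fun m => by
    rw [Real.rpow_neg h2.le, one_div, ← Real.rpow_natCast]
  rw [e, e, ← Real.rpow_mul h2.le, ← Real.rpow_natCast, ← Real.rpow_natCast, ← Real.rpow_mul h2.le,
    ← Real.rpow_mul h2.le, ← Real.rpow_add h2, ← Real.rpow_add h2, ← Real.rpow_add h2]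
  congr 1; push_cast; ring

/-- Pathwise convergence rate of the normalised energy of Faber–Schauder coefficients. -/
lemma exists_abs_sum_vartheta_sq_sub_le {H κ β x₀ C₁ C₂ C₃ C₄ : ℝ} {w D x g : ℝ → ℝ} {l : ℕ → ℕ}
    (hH : H ∈ Ioo (0 : ℝ) 1) (hκ : 0 < κ) (hκβ : κ ≤ β) (hβ : H + κ ≤ 2 * β)
    (hl : ∀ n, l n ≤ n) (hlβ : ∀ n, κ * n ≤ β * (l n + 1)) (hg : ContDiff ℝ 2 g)
    (hwc : ContinuousOn w (Icc 0 1)) (hDc : ContinuousOn D (Icc 0 1))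
    (hx : ∀ t ∈ Icc (0 : ℝ) 1, x t = x₀ + w t + D t)
    (hw : ∀ n k : ℕ, k < 2 ^ n → ∀ s ∈ Icc ((k : ℝ) / 2 ^ n) ((k + 1 : ℝ) / 2 ^ n),
      |w s - w ((k : ℝ) / 2 ^ n)| ≤ C₁ * ((2 : ℝ) ^ (-β)) ^ n)
    (hD : ∀ n k : ℕ, k < 2 ^ n → ∀ s ∈ Icc ((k : ℝ) / 2 ^ n) ((k + 1 : ℝ) / 2 ^ n),
      |D s - D ((k : ℝ) / 2 ^ n)| ≤ C₂ * ((2 : ℝ) ^ (-β)) ^ n)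
    (hD' : ∀ n k : ℕ, k < 2 ^ n → ∃ A, ∀ s ∈ Icc ((k : ℝ) / 2 ^ n) ((k + 1 : ℝ) / 2 ^ n),
      |D s - D ((k : ℝ) / 2 ^ n) - A * (s - (k : ℝ) / 2 ^ n)| ≤ C₃ * ((2 : ℝ) ^ (-(H + κ))) ^ n)
    (hQ : ∀ n : ℕ, ∑ b ∈ Finset.range (2 ^ l n),
      |∑ k ∈ Finset.Ico (b * 2 ^ (n - l n)) (b * 2 ^ (n - l n) + 2 ^ (n - l n)),
        (fsDiff (fun t => ∫ s in (0 : ℝ)..t, w s) (4 * k * (1 / 2 ^ (n + 2))) (1 / 2 ^ (n + 2)) ^ 2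
          / ((1 / 2 ^ (n + 2)) ^ (2 * H + 2) * fsCov H 0) - 1)| ≤
      C₄ * (2 ^ n * ((2 : ℝ) ^ (-κ)) ^ n))
    (hV : 0 < ∫ s in (0 : ℝ)..1, (deriv g (x s)) ^ 2) :
    ∃ V : ℝ, 0 < V ∧ ∃ C : ℝ, 0 ≤ C ∧ ∀ n : ℕ,
      |((2 : ℝ) ^ (-(2 * (1 - H)))) ^ n * ∑ k ∈ Finset.range (2 ^ n),
        vartheta (fun t => ∫ s in (0 : ℝ)..t, g (x s)) n k ^ 2 - V| ≤ C * ((2 : ℝ) ^ (-κ)) ^ n := by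
  have hc0 := fsCov_zero_pos hH
  have hg1c : Continuous (deriv g) := hg.continuous_deriv (by norm_num)
  have hxc : ContinuousOn x (Icc 0 1) :=
    ((continuousOn_const.add hwc).add hDc).congr hx
  obtain ⟨R, hR⟩ := isCompact_Icc.exists_bound_of_continuousOn hxc
  have hxR : ∀ t ∈ Icc (0 : ℝ) 1, x t ∈ Icc (-R) R := fun t ht => abs_le.1 (hR t ht)
  obtain ⟨B, hB0, hB⟩ := exists_taylor_bound hg R
  set q : ℝ := (2 : ℝ) ^ (-κ) with hq
  have hqpos : 0 < q := by positivity
  have hq1 : q ≤ 1 := Real.rpow_le_one_of_one_le_of_nonpos one_le_two (by linarith)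
  have hqn1 : ∀ n : ℕ, q ^ n ≤ 1 := fun n => pow_le_one₀ hqpos.le hq1
  set r : ℝ := (2 : ℝ) ^ (-β) with hr
  have hrpos : 0 < r := by positivity
  have h20 : (0 : ℝ) ≤ 2 := zero_le_two
  have h20' : (0 : ℝ) < 2 := zero_lt_two
  have hrq : ∀ n : ℕ, r ^ n ≤ q ^ n := fun n => by
    refine pow_le_pow_left₀ hrpos.le ?_ n
    exact Real.rpow_le_rpow_of_exponent_le one_le_two (by linarith)
  have hC₁ : 0 ≤ C₁ := by
    have := (abs_nonneg _).trans (hw 0 0 (by norm_num) 0 (by simp))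
    simpa using this
  have hC₂ : 0 ≤ C₂ := by
    have := (abs_nonneg _).trans (hD 0 0 (by norm_num) 0 (by simp))
    simpa using this
  have hC₃ : 0 ≤ C₃ := by
    obtain ⟨A, hA⟩ := hD' 0 0 (by norm_num)
    have := (abs_nonneg _).trans (hA 0 (by simp))
    simpa using this
  have hC₄ : 0 ≤ C₄ := by
    have := (Finset.sum_nonneg fun b _ => abs_nonneg _).trans (hQ 0)
    simpa using this
  have hmem : ∀ n k : ℕ, k < 2 ^ n →
      Icc ((k : ℝ) / 2 ^ n) ((k + 1 : ℝ) / 2 ^ n) ⊆ Icc 0 1 := fun n k hk => by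
    have : (k : ℝ) + 1 ≤ 2 ^ n := by exact_mod_cast hk
    exact Icc_subset_Icc (by positivity) ((div_le_one (by positivity)).2 this)
  have hleft : ∀ n k : ℕ, (k : ℝ) / 2 ^ n ∈ Icc ((k : ℝ) / 2 ^ n) ((k + 1 : ℝ) / 2 ^ n) :=
    fun n k => left_mem_Icc.2 (by gcongr; linarith)
  have hxH : ∀ n k : ℕ, k < 2 ^ n → ∀ s ∈ Icc ((k : ℝ) / 2 ^ n) ((k + 1 : ℝ) / 2 ^ n),
      |x s - x ((k : ℝ) / 2 ^ n)| ≤ (C₁ + C₂) * r ^ n := by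
    intro n k hk s hs
    rw [hx s (hmem n k hk hs), hx _ (hmem n k hk (hleft n k))]
    calc _ = |(w s - w ((k : ℝ) / 2 ^ n)) + (D s - D ((k : ℝ) / 2 ^ n))| := by congr 1; ring
      _ ≤ _ := (abs_add_le _ _).trans (by linarith [hw n k hk s hs, hD n k hk s hs])
  -- squared derivatives along the path
  set h : ℝ → ℝ := fun s => deriv g (x s) ^ 2 with hh
  set C₅ : ℝ := B * (C₁ + C₂) * (2 * B) with hC₅
  have hC₅0 : 0 ≤ C₅ := by positivity
  have hhH : ∀ n k : ℕ, k < 2 ^ n → ∀ s ∈ Icc ((k : ℝ) / 2 ^ n) ((k + 1 : ℝ) / 2 ^ n),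
      |h s - h ((k : ℝ) / 2 ^ n)| ≤ C₅ * r ^ n := by
    intro n k hk s hs
    have m1 := hxR s (hmem n k hk hs)
    have m2 := hxR _ (hmem n k hk (hleft n k))
    obtain ⟨b1, -, b3⟩ := hB _ m2 _ m1
    have b1' := (hB _ m1 _ m2).1
    have e : h s - h ((k : ℝ) / 2 ^ n) = (deriv g (x s) - deriv g (x ((k : ℝ) / 2 ^ n))) *
        (deriv g (x s) + deriv g (x ((k : ℝ) / 2 ^ n))) := by simp only [hh]; ring
    rw [e, abs_mul]
    have i1 : |deriv g (x s) - deriv g (x ((k : ℝ) / 2 ^ n))| ≤ B * ((C₁ + C₂) * r ^ n) :=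
      b3.trans (mul_le_mul_of_nonneg_left (hxH n k hk s hs) hB0)
    have i2 : |deriv g (x s) + deriv g (x ((k : ℝ) / 2 ^ n))| ≤ 2 * B :=
      (abs_add_le _ _).trans (by linarith)
    calc _ ≤ (B * ((C₁ + C₂) * r ^ n)) * (2 * B) :=
          mul_le_mul i1 i2 (abs_nonneg _) (by positivity)
      _ = _ := by rw [hC₅]; ring
  have hhc : ContinuousOn h (Icc 0 1) := (hg1c.comp_continuousOn hxc).pow 2
  have hII : ∀ {f : ℝ → ℝ}, ContinuousOn f (Icc 0 1) → IntervalIntegrable f volume 0 1 :=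
    fun hf => ContinuousOn.intervalIntegrable (by rwa [uIcc_of_le zero_le_one])
  -- the linearisation error of a single coefficient
  set K : ℝ := B * (C₁ + C₂) ^ 2 + B * C₃ with hK
  have hK0 : 0 ≤ K := by positivity
  have hcoef : ∀ n k : ℕ, k < 2 ^ n →
      |fsDiff (fun t => ∫ s in (0 : ℝ)..t, g (x s)) (4 * k * (1 / 2 ^ (n + 2))) (1 / 2 ^ (n + 2)) -
        deriv g (x ((k : ℝ) / 2 ^ n)) *
        fsDiff (fun t => ∫ s in (0 : ℝ)..t, w s) (4 * k * (1 / 2 ^ (n + 2))) (1 / 2 ^ (n + 2))| ≤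
      12 * (1 / 2 ^ (n + 2)) * (K * ((2 : ℝ) ^ (-(H + κ))) ^ n) := by
    intro n k hk
    obtain ⟨A, hA⟩ := hD' n k hk
    have et : 4 * (k : ℝ) * (1 / 2 ^ (n + 2)) = k / 2 ^ n := by
      rw [pow_add]; field_simp; ring
    have et' : (k : ℝ) / 2 ^ n + 4 * (1 / 2 ^ (n + 2)) = (k + 1) / 2 ^ n := by
      rw [pow_add]; field_simp; ring
    rw [et]
    set t : ℝ := (k : ℝ) / 2 ^ n with ht
    have htm : t ∈ Icc t ((k + 1 : ℝ) / 2 ^ n) := hleft n k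
    refine abs_fsDiff_integral_sub_le (c := g (x t) - deriv g (x t) * w t)
      (A := deriv g (x t) * A) (by positivity) (by positivity) ?_
      (hII (hg.continuous.comp_continuousOn hxc)) (hII hwc) ?_
    · rw [et']
      exact (hmem n k hk (right_mem_Icc.2 (htm.2))).2
    · rw [et']
      intro s hs
      have m1 := hxR s (hmem n k hk hs)
      have m2 := hxR _ (hmem n k hk htm)
      obtain ⟨b1, b2, -⟩ := hB _ m2 _ m1
      have e : g (x s) - deriv g (x t) * w s - (g (x t) - deriv g (x t) * w t) -
          deriv g (x t) * A * (s - t) =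
          (g (x s) - g (x t) - deriv g (x t) * (x s - x t)) +
            deriv g (x t) * (D s - D t - A * (s - t)) := by
        rw [hx s (hmem n k hk hs), hx t (hmem n k hk htm)]; ring
      rw [e]
      refine (abs_add_le _ _).trans ?_
      rw [abs_mul]
      have hr2 : (r ^ n) ^ 2 ≤ ((2 : ℝ) ^ (-(H + κ))) ^ n := by
        rw [← pow_mul, mul_comm, pow_mul]
        refine pow_le_pow_left₀ (by positivity) ?_ n
        rw [hr, ← Real.rpow_natCast, ← Real.rpow_mul h20]
        exact Real.rpow_le_rpow_of_exponent_le one_le_two (by push_cast; linarith)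
      have i1 : B * (x s - x t) ^ 2 ≤ B * (C₁ + C₂) ^ 2 * ((2 : ℝ) ^ (-(H + κ))) ^ n := by
        rw [← sq_abs]
        calc _ ≤ B * ((C₁ + C₂) * r ^ n) ^ 2 := by
              have := hxH n k hk s hs
              gcongr
          _ = B * (C₁ + C₂) ^ 2 * (r ^ n) ^ 2 := by ring
          _ ≤ _ := by gcongr
      have i2 := mul_le_mul b1 (hA s hs) (abs_nonneg _) hB0
      rw [hK]
      linarith
  set K' : ℝ := 12 * K * 2 ^ (2 * H) / Real.sqrt (fsCov H 0) with hK'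
  have hK'0 : 0 ≤ K' := by positivity
  refine ⟨2 ^ (2 - 4 * H) * fsCov H 0 * ∫ s in (0 : ℝ)..1, h s, by positivity,
    2 ^ (2 - 4 * H) * fsCov H 0 * (B ^ 2 * C₄ + C₅ * 2 ^ β * (2 + C₄) +
      K' * (B * (2 + C₄) + K') + C₅), by positivity, fun n => ?_⟩
  set δ : ℝ := 1 / 2 ^ (n + 2) with hδ
  have hδpos : 0 < δ := by positivity
  set v : ℝ := δ ^ (2 * H + 2) * fsCov H 0 with hv
  have hvpos : 0 < v := by positivity
  set Λ : ℕ → ℝ := fun k => fsDiff (fun t => ∫ s in (0 : ℝ)..t, w s) (4 * k * δ) δ with hΛ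
  set Y : ℕ → ℝ := fun k => fsDiff (fun t => ∫ s in (0 : ℝ)..t, g (x s)) (4 * k * δ) δ with hY
  have hsplit : 2 ^ l n * 2 ^ (n - l n) = 2 ^ n := by
    rw [← pow_add, Nat.add_sub_cancel' (hl n)]
  have hsplitR : (2 : ℝ) ^ l n * 2 ^ (n - l n) = 2 ^ n := by exact_mod_cast hsplit
  have hδpow : ∀ p : ℝ, δ ^ p = (2 : ℝ) ^ (-((n + 2) * p)) := by
    intro p
    rw [hδ, one_div, Real.inv_rpow (by positivity), ← Real.rpow_natCast, ← Real.rpow_mul h20,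
      ← Real.rpow_neg h20]
    push_cast
    rfl
  have hsqrt : Real.sqrt v = δ ^ (H + 1) * Real.sqrt (fsCov H 0) := by
    rw [hv, Real.sqrt_mul (by positivity)]
    congr 1
    rw [Real.sqrt_eq_rpow, ← Real.rpow_mul hδpos.le]
    congr 1; ring
  have hblock := abs_sum_sq_sub_le_of_block (A := 2 ^ l n) (M := 2 ^ (n - l n))
    (a := fun k => deriv g (x ((k : ℝ) / 2 ^ n))) (ζ := fun k => Λ k / Real.sqrt v)
    (y := fun k => Y k / Real.sqrt v) (B := B) (η := C₅ * 2 ^ β * q ^ n) (σ := C₄ * q ^ n)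
    (ε := K' * q ^ n) hB0 (by positivity) (by positivity)
    (fun k hk => by
      rw [hsplit] at hk
      have m := hxR _ (hmem n k hk (hleft n k))
      exact (hB _ m _ m).1)
    (fun b hb k hk => by
      rw [Finset.mem_Ico] at hk
      have e1 : ((b * 2 ^ (n - l n) : ℕ) : ℝ) / 2 ^ n = b / 2 ^ l n := by
        rw [← hsplitR]; push_cast; field_simp
      rw [e1]
      have := hhH (l n) b hb ((k : ℝ) / 2 ^ n) (by
        rw [← e1]
        constructor
        · gcongr; exact hk.1
        · have e2 : (b + 1 : ℝ) / 2 ^ l n = ((b * 2 ^ (n - l n) + 2 ^ (n - l n) : ℕ) : ℝ) / 2 ^ n := by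
            rw [← hsplitR]; push_cast; field_simp
          rw [e2]
          gcongr
          exact hk.2.le)
      refine this.trans ?_
      rw [mul_assoc C₅]
      refine mul_le_mul_of_nonneg_left ?_ hC₅0
      rw [hr, hq, ← Real.rpow_natCast, ← Real.rpow_natCast, ← Real.rpow_mul h20,
        ← Real.rpow_mul h20, ← Real.rpow_add h20']
      exact Real.rpow_le_rpow_of_exponent_le one_le_two (by linarith [hlβ n]))
    (by
      rw [hsplit]
      refine le_of_eq_of_le ?_ ((hQ n).trans (le_of_eq (by push_cast; ring)))
      refine Finset.sum_congr rfl fun b _ => ?_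
      congr 1
      refine Finset.sum_congr rfl fun k _ => ?_
      rw [div_pow, Real.sq_sqrt hvpos.le])
    (fun k hk => by
      rw [hsplit] at hk
      have e1 : Y k / Real.sqrt v - deriv g (x ((k : ℝ) / 2 ^ n)) * (Λ k / Real.sqrt v) =
          (Y k - deriv g (x ((k : ℝ) / 2 ^ n)) * Λ k) / Real.sqrt v := by ring
      rw [e1, abs_div, abs_of_pos (Real.sqrt_pos.2 hvpos), div_le_iff₀ (Real.sqrt_pos.2 hvpos)]
      refine (hcoef n k hk).trans (le_of_eq ?_)
      have : Real.sqrt (fsCov H 0) ≠ 0 := (Real.sqrt_pos.2 hc0).ne'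
      have e3 : 12 * δ * (K * ((2 : ℝ) ^ (-(H + κ))) ^ n) =
          12 * K * (δ * ((2 : ℝ) ^ (-(H + κ))) ^ n) := by ring
      rw [hsqrt, e3, hδ, mul_rpow_pow_eq, hK', ← hδ, ← hq]
      field_simp)
  rw [hsplit] at hblock
  have hscale : ((2 : ℝ) ^ (-(2 * (1 - H)))) ^ n * ∑ k ∈ Finset.range (2 ^ n),
      vartheta (fun t => ∫ s in (0 : ℝ)..t, g (x s)) n k ^ 2 =
      2 ^ (2 - 4 * H) * fsCov H 0 * (1 / ((2 ^ n : ℕ) : ℝ) *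
        ∑ k ∈ Finset.range (2 ^ n), (Y k / Real.sqrt v) ^ 2) := by
    rw [Finset.mul_sum, Finset.mul_sum, Finset.mul_sum]
    refine Finset.sum_congr rfl fun k _ => ?_
    have e4 : fsCov H 0 * (1 / v) = 1 / δ ^ (2 * H + 2) := by
      rw [hv]; field_simp
    have e5 := scale_mul_sq_mul_eq H n
    rw [← hδ] at e5
    rw [vartheta_eq_fsDiff, ← hδ, div_pow, Real.sq_sqrt hvpos.le]
    have hδp : 0 < δ ^ (2 * H + 2) := by positivity
    push_cast
    calc _ = ((2 : ℝ) ^ (-(2 * (1 - H)))) ^ n * ((2 : ℝ) ^ ((3 * (n : ℝ)) / 2 + 3)) ^ 2 *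
          Y k ^ 2 := by simp only [hY]; ring
      _ = (2 ^ (2 - 4 * H) * (1 / 2 ^ n)) * (1 / δ ^ (2 * H + 2)) * Y k ^ 2 := by
          rw [← e5]; field_simp
      _ = _ := by rw [← e4]; ring
  have hriem := abs_riemann_sum_sub_integral_le (f := h) (N := 2 ^ n) (ε := C₅ * q ^ n)
    (by positivity) (hII hhc) (fun j hj s hs => by
      push_cast at hs ⊢
      refine (hhH n j hj s hs).trans ?_
      exact mul_le_mul_of_nonneg_left (hrq n) hC₅0)
  rw [hscale]
  set Cst : ℝ := 2 ^ (2 - 4 * H) * fsCov H 0 with hCst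
  have hCst0 : 0 < Cst := by positivity
  set N : ℝ := ((2 ^ n : ℕ) : ℝ) with hN
  have hNpos : 0 < N := by positivity
  have hb2 : |1 / N * ∑ k ∈ Finset.range (2 ^ n),
      ((Y k / Real.sqrt v) ^ 2 - deriv g (x ((k : ℝ) / 2 ^ n)) ^ 2)| ≤
      (B ^ 2 * C₄ + C₅ * 2 ^ β * (2 + C₄) + K' * (B * (2 + C₄) + K')) * q ^ n := by
    rw [abs_mul, abs_of_pos (by positivity : 0 < 1 / N), one_div, inv_mul_le_iff₀ hNpos]
    refine hblock.trans ?_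
    refine mul_le_mul_of_nonneg_left ?_ hNpos.le
    have u1 : C₄ * q ^ n ≤ C₄ := mul_le_of_le_one_right hC₄ (hqn1 n)
    have u2 : K' * q ^ n ≤ K' := mul_le_of_le_one_right hK'0 (hqn1 n)
    have u0 : 0 ≤ q ^ n := by positivity
    calc B ^ 2 * (C₄ * q ^ n) + C₅ * 2 ^ β * q ^ n * (2 + C₄ * q ^ n) +
          K' * q ^ n * (B * (2 + C₄ * q ^ n) + K' * q ^ n)
        ≤ B ^ 2 * (C₄ * q ^ n) + C₅ * 2 ^ β * q ^ n * (2 + C₄) +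
          K' * q ^ n * (B * (2 + C₄) + K') := by gcongr
      _ = _ := by ring
  have e6 : Cst * (1 / N * ∑ k ∈ Finset.range (2 ^ n), (Y k / Real.sqrt v) ^ 2) -
      Cst * ∫ s in (0 : ℝ)..1, h s =
      Cst * (1 / N * ∑ k ∈ Finset.range (2 ^ n),
        ((Y k / Real.sqrt v) ^ 2 - deriv g (x ((k : ℝ) / 2 ^ n)) ^ 2) +
      (1 / N * ∑ k ∈ Finset.range (2 ^ n), h (k / N) - ∫ s in (0 : ℝ)..1, h s)) := by
    rw [Finset.sum_sub_distrib]
    simp only [hh, hN]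
    push_cast
    ring
  rw [e6, abs_mul, abs_of_pos hCst0, mul_assoc Cst]
  refine mul_le_mul_of_nonneg_left ?_ hCst0.le
  refine (abs_add_le _ _).trans ((add_le_add hb2 hriem).trans (le_of_eq ?_))
  ring

/-! ### The sequential scale estimator -/

lemma vartheta_const_mul (η : ℝ) (f : ℝ → ℝ) (n k : ℕ) :
    vartheta (fun t => η * f t) n k = η * vartheta f n k := by
  unfold vartheta; ring

lemma Rhat_const_mul (H : ℝ) {η : ℝ} {f : ℝ → ℝ} {n : ℕ} (hn : 0 < n) (hη : 0 < η)
    (hS : 0 < ((2 : ℝ) ^ (-(2 * (1 - H)))) ^ n * ∑ k ∈ Finset.range (2 ^ n), vartheta f n k ^ 2) :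
    Rhat n (fun t => η * f t) = H - (Real.logb 2 η + Real.logb 2 (((2 : ℝ) ^ (-(2 * (1 - H)))) ^ n *
      ∑ k ∈ Finset.range (2 ^ n), vartheta f n k ^ 2) / 2) / n := by
  have hn' : (n : ℝ) ≠ 0 := by positivity
  have hρ : (0 : ℝ) < ((2 : ℝ) ^ (-(2 * (1 - H)))) ^ n := by positivity
  have hS' : 0 < ∑ k ∈ Finset.range (2 ^ n), vartheta f n k ^ 2 := pos_of_mul_pos_right hS hρ.le
  unfold Rhat
  simp only [vartheta_const_mul, mul_pow]
  rw [← Finset.mul_sum, Real.sqrt_eq_rpow, Real.logb_rpow_eq_mul_logb_of_pos (by positivity),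
    Real.logb_mul (by positivity) hS'.ne', Real.logb_mul hρ.ne' hS'.ne', Real.logb_pow,
    Real.logb_pow, Real.logb_rpow (by norm_num) (by norm_num)]
  push_cast
  field_simp
  ring

lemma abs_logb_sub_logb_le {u V : ℝ} (hV : 0 < V) (hu : |u - V| ≤ V / 2) :
    |Real.logb 2 u - Real.logb 2 V| ≤ 2 / (V * Real.log 2) * |u - V| := by
  have h2 : 0 < Real.log 2 := Real.log_pos one_lt_two
  have hu' := abs_le.1 hu
  have hu0 : V / 2 ≤ u := by linarith
  have hupos : 0 < u := by linarith
  have key : |Real.log u - Real.log V| ≤ 2 / V * |u - V| := by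
    rw [← Real.log_div hupos.ne' hV.ne', abs_le]
    constructor
    · have h1 := Real.one_sub_inv_le_log_of_pos (div_pos hupos hV)
      have h3 : 1 - (u / V)⁻¹ = (u - V) / u := by field_simp
      have h4 : -(2 / V * |u - V|) ≤ (u - V) / u := by
        have : |u - V| / u ≤ 2 / V * |u - V| := by
          rw [div_le_iff₀ hupos]
          have : 1 ≤ 2 / V * u := by
            rw [div_mul_eq_mul_div, le_div_iff₀ hV]; linarith
          nlinarith [abs_nonneg (u - V)]
        have h5 : -(|u - V| / u) ≤ (u - V) / u := by
          rw [← neg_div]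
          gcongr
          exact neg_abs_le _
        linarith
      linarith
    · have h1 := Real.log_le_sub_one_of_pos (div_pos hupos hV)
      have h3 : u / V - 1 = (u - V) / V := by field_simp
      have h4 : (u - V) / V ≤ 2 / V * |u - V| := by
        rw [div_mul_eq_mul_div]
        gcongr
        linarith [le_abs_self (u - V), abs_nonneg (u - V)]
      linarith
  rw [Real.logb, Real.logb, ← sub_div, abs_div, abs_of_pos h2, div_le_iff₀ h2]
  refine key.trans (le_of_eq ?_)
  field_simp

/-- Convergence rate of the sequential scale estimator for a path whose normalised energies
converge geometrically. -/
lemma exists_abs_Rhat_sequential_sub_le {H κ γ V C : ℝ} {f : ℝ → ℝ} {m : ℕ} {a η : ℕ → ℝ}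
    (hκ : 0 < κ) (hγ : γ < κ) (hV : 0 < V)
    (hS : ∀ n : ℕ, |((2 : ℝ) ^ (-(2 * (1 - H)))) ^ n *
      ∑ k ∈ Finset.range (2 ^ n), vartheta f n k ^ 2 - V| ≤ C * ((2 : ℝ) ^ (-κ)) ^ n)
    (ha0 : 0 < a 0) (ha : ∀ j ≤ m, 0 ≤ a j)
    (hη : ∀ n, m < n → 0 < η n ∧ ∀ η' : ℝ, 0 < η' →
      (∑ k ∈ Finset.Icc (n - m) n, a (n - k) *
        (Rhat k (fun t => η n * f t) - Rhat (k - 1) (fun t => η n * f t)) ^ 2) ≤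
      (∑ k ∈ Finset.Icc (n - m) n, a (n - k) *
        (Rhat k (fun t => η' * f t) - Rhat (k - 1) (fun t => η' * f t)) ^ 2)) :
    ∃ C' : ℝ, ∀ᶠ n : ℕ in atTop,
      |Rhat n (fun t => η n * f t) - H| ≤ C' * (Real.sqrt n * (2 : ℝ) ^ (-γ * n)) := by
  have hlog2 : 0 < Real.log 2 := Real.log_pos one_lt_two
  set q : ℝ := (2 : ℝ) ^ (-κ) with hq
  have hqpos : 0 < q := by positivity
  have hq1 : q < 1 := Real.rpow_lt_one_of_one_lt_of_neg one_lt_two (by linarith)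
  have hC : 0 ≤ C := by simpa using (abs_nonneg _).trans (hS 0)
  set u : ℕ → ℝ := fun n => ((2 : ℝ) ^ (-(2 * (1 - H)))) ^ n *
      ∑ k ∈ Finset.range (2 ^ n), vartheta f n k ^ 2 with hu
  have hlim : Tendsto (fun n : ℕ => C * q ^ n) atTop (𝓝 0) := by
    simpa using (tendsto_pow_atTop_nhds_zero_of_lt_one hqpos.le hq1).const_mul C
  obtain ⟨n₀, hn₀⟩ := eventually_atTop.1 (hlim.eventually (ge_mem_nhds (half_pos hV)))
  have hnear : ∀ n, n₀ ≤ n → |u n - V| ≤ V / 2 := fun n hn => (hS n).trans (hn₀ n hn)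
  have hupos : ∀ n, n₀ ≤ n → 0 < u n := fun n hn => by
    linarith [(abs_le.1 (hnear n hn)).1]
  set L : ℝ := Real.logb 2 V / 2 with hL
  set ε : ℕ → ℝ := fun n => Real.logb 2 (u n) / 2 - L with hε
  set C₁ : ℝ := 1 / (V * Real.log 2) * C with hC₁
  have hC₁0 : 0 ≤ C₁ := by positivity
  have hεle : ∀ n, n₀ ≤ n → |ε n| ≤ C₁ * q ^ n := fun n hn => by
    have h1 := abs_logb_sub_logb_le hV (hnear n hn)
    have e : ε n = (Real.logb 2 (u n) - Real.logb 2 V) / 2 := by simp only [hε, hL]; ring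
    rw [e, abs_div, abs_two, div_le_iff₀ two_pos]
    calc _ ≤ 2 / (V * Real.log 2) * (C * q ^ n) := h1.trans (by gcongr; exact hS n)
      _ = _ := by rw [hC₁]; ring
  have hR : ∀ n, n₀ ≤ n → 0 < n → ∀ η' : ℝ, 0 < η' →
      Rhat n (fun t => η' * f t) = H - (Real.logb 2 η' + L + ε n) / n := fun n hn hn' η' hη' => by
    rw [Rhat_const_mul H hn' hη' (hupos n hn)]
    simp only [hε]
    ring
  set C₂ : ℝ := 2 * C₁ * (q ^ (m + 1))⁻¹ with hC₂
  have hC₂0 : 0 ≤ C₂ := by positivity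
  set e : ℕ → ℝ := fun k => ε (k - 1) / (k - 1 : ℕ) - ε k / k with he
  have hele : ∀ n k, n₀ + m + 2 ≤ n → k ∈ Finset.Icc (n - m) n → |e k| ≤ C₂ * q ^ n := by
    intro n k hn hk
    rw [Finset.mem_Icc] at hk
    have hdiv : ∀ (z : ℝ) (j : ℕ), 0 < j → |z / j| ≤ |z| := fun z j hj => by
      rw [abs_div]
      refine div_le_self (abs_nonneg _) ?_
      rw [Nat.abs_cast]; exact_mod_cast hj
    have hpw : ∀ j, n ≤ j + (m + 1) → q ^ j ≤ q ^ n * (q ^ (m + 1))⁻¹ := fun j hj => by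
      rw [← div_eq_mul_inv, le_div_iff₀ (by positivity), ← pow_add]
      exact pow_le_pow_of_le_one hqpos.le hq1.le hj
    have h1 : |ε (k - 1) / (k - 1 : ℕ)| ≤ C₁ * (q ^ n * (q ^ (m + 1))⁻¹) :=
      (hdiv _ _ (by omega)).trans ((hεle _ (by omega)).trans (by
        gcongr; exact hpw _ (by omega)))
    have h2 : |ε k / k| ≤ C₁ * (q ^ n * (q ^ (m + 1))⁻¹) :=
      (hdiv _ _ (by omega)).trans ((hεle _ (by omega)).trans (by
        gcongr; exact hpw _ (by omega)))
    refine (abs_sub _ _).trans ((add_le_add h1 h2).trans (le_of_eq ?_))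
    rw [hC₂]; ring
  have hdiff : ∀ k, n₀ + 2 ≤ k → ∀ η' : ℝ, 0 < η' →
      Rhat k (fun t => η' * f t) - Rhat (k - 1) (fun t => η' * f t) =
      (Real.logb 2 η' + L) / (k * (k - 1 : ℕ)) + e k := by
    intro k hk η' hη'
    rw [hR k (by omega) (by omega) η' hη', hR (k - 1) (by omega) (by omega) η' hη']
    obtain ⟨j, rfl⟩ : ∃ j, k = j + 2 := ⟨k - 2, by omega⟩
    simp only [he, show j + 2 - 1 = j + 1 by omega]
    push_cast
    field_simp
    ring
  set A : ℝ := ∑ j ∈ Finset.range (m + 1), a j with hA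
  have hA0 : 0 ≤ A := Finset.sum_nonneg fun j hj => ha j (by
    rw [Finset.mem_range] at hj; omega)
  set C₃ : ℝ := Real.sqrt (A / a 0) * C₂ with hC₃
  have hC₃0 : 0 ≤ C₃ := by positivity
  have hlam : ∀ n, n₀ + m + 2 ≤ n → |Real.logb 2 (η n) + L| ≤ (n : ℝ) ^ 2 * ((C₃ + C₂) * q ^ n) := by
    intro n hn
    obtain ⟨hηpos, hmin⟩ := hη n (by omega)
    have hη₀ : (0 : ℝ) < 2 ^ (-L) := by positivity
    have h1 := hmin _ hη₀
    set d : ℝ := Rhat n (fun t => η n * f t) - Rhat (n - 1) (fun t => η n * f t) with hd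
    have hleft : a 0 * d ^ 2 ≤ ∑ k ∈ Finset.Icc (n - m) n, a (n - k) *
        (Rhat k (fun t => η n * f t) - Rhat (k - 1) (fun t => η n * f t)) ^ 2 := by
      have := Finset.single_le_sum (s := Finset.Icc (n - m) n) (f := fun k => a (n - k) *
        (Rhat k (fun t => η n * f t) - Rhat (k - 1) (fun t => η n * f t)) ^ 2) (fun k hk => by
          rw [Finset.mem_Icc] at hk
          exact mul_nonneg (ha _ (by omega)) (sq_nonneg _)) (a := n) (by simp)
      simpa using this
    have hright : ∑ k ∈ Finset.Icc (n - m) n, a (n - k) *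
        (Rhat k (fun t => 2 ^ (-L) * f t) - Rhat (k - 1) (fun t => 2 ^ (-L) * f t)) ^ 2 ≤
        A * (C₂ * q ^ n) ^ 2 := by
      have hsum : A = ∑ k ∈ Finset.Icc (n - m) n, a (n - k) := by
        rw [hA]
        refine Finset.sum_nbij' (fun j => n - j) (fun k => n - k) ?_ ?_ ?_ ?_ ?_
        · intro j hj; rw [Finset.mem_range] at hj; rw [Finset.mem_Icc]; omega
        · intro j hj; rw [Finset.mem_Icc] at hj; rw [Finset.mem_range]; omega
        · intro j hj; rw [Finset.mem_range] at hj; omega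
        · intro j hj; rw [Finset.mem_Icc] at hj; omega
        · intro j hj; rw [Finset.mem_range] at hj; congr 1; omega
      rw [hsum, Finset.sum_mul]
      refine Finset.sum_le_sum fun k hk => ?_
      have hk' := Finset.mem_Icc.1 hk
      refine mul_le_mul_of_nonneg_left ?_ (ha _ (by omega))
      rw [hdiff k (by omega) _ hη₀, Real.logb_rpow two_pos (by norm_num), neg_add_cancel, zero_div,
        zero_add, ← sq_abs]
      have := hele n k hn hk
      gcongr
    have hd2 : d ^ 2 ≤ (C₃ * q ^ n) ^ 2 := by
      have h3 : a 0 * d ^ 2 ≤ A * (C₂ * q ^ n) ^ 2 := hleft.trans (h1.trans hright)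
      have e1 : (C₃ * q ^ n) ^ 2 = A * (C₂ * q ^ n) ^ 2 / a 0 := by
        rw [hC₃, mul_pow, mul_pow, Real.sq_sqrt (by positivity)]; ring
      rw [e1, le_div_iff₀ ha0]; linarith
    have hd' : |d| ≤ C₃ * q ^ n := abs_le_of_sq_le_sq hd2 (by positivity)
    have hdn : d = (Real.logb 2 (η n) + L) / (n * (n - 1 : ℕ)) + e n :=
      hdiff n (by omega) _ hηpos
    have he' := hele n n hn (by simp)
    have hnn : (0 : ℝ) < n * (n - 1 : ℕ) := by
      have h1 : 0 < n := by omega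
      have h2 : 0 < n - 1 := by omega
      positivity
    have e2 : Real.logb 2 (η n) + L = n * (n - 1 : ℕ) * (d - e n) := by
      rw [hdn, add_sub_cancel_right, mul_div_cancel₀ _ hnn.ne']
    rw [e2, abs_mul, abs_of_pos hnn, sq]
    have h5 : |d - e n| ≤ (C₃ + C₂) * q ^ n := (abs_sub _ _).trans (by linarith)
    have h6 : ((n - 1 : ℕ) : ℝ) ≤ n := by exact_mod_cast Nat.sub_le n 1
    gcongr
  have hdecay : Tendsto (fun n : ℕ => (n : ℝ) ^ 2 * ((2 : ℝ) ^ (γ - κ)) ^ n) atTop (𝓝 0) := by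
    refine tendsto_pow_const_mul_const_pow_of_abs_lt_one 2 ?_
    rw [abs_of_pos (by positivity)]
    exact Real.rpow_lt_one_of_one_lt_of_neg one_lt_two (by linarith)
  refine ⟨C₃ + C₂ + C₁, ?_⟩
  filter_upwards [eventually_ge_atTop (n₀ + m + 2),
    hdecay.eventually (ge_mem_nhds one_pos)] with n hn hdec
  have hn1 : (1 : ℝ) ≤ n := by exact_mod_cast (by omega : 1 ≤ n)
  rw [hR n (by omega) (by omega) _ (hη n (by omega)).1]
  have e3 : q ^ n = ((2 : ℝ) ^ (γ - κ)) ^ n * (2 : ℝ) ^ (-γ * n) := by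
    rw [hq, ← Real.rpow_natCast, ← Real.rpow_natCast, ← Real.rpow_mul two_pos.le,
      ← Real.rpow_mul two_pos.le, ← Real.rpow_add two_pos]
    congr 1; ring
  have hg0 : (0 : ℝ) < (2 : ℝ) ^ (-γ * n) := by positivity
  calc |H - (Real.logb 2 (η n) + L + ε n) / n - H| = |Real.logb 2 (η n) + L + ε n| / n := by
        rw [sub_sub_cancel_left, abs_neg, abs_div, Nat.abs_cast]
    _ ≤ |Real.logb 2 (η n) + L + ε n| := div_le_self (abs_nonneg _) hn1
    _ ≤ (n : ℝ) ^ 2 * ((C₃ + C₂) * q ^ n) + C₁ * q ^ n :=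
        (abs_add_le _ _).trans (add_le_add (hlam n hn) (hεle n (by omega)))
    _ ≤ (n : ℝ) ^ 2 * ((C₃ + C₂) * q ^ n) + (n : ℝ) ^ 2 * (C₁ * q ^ n) := by
        have : C₁ * q ^ n ≤ (n : ℝ) ^ 2 * (C₁ * q ^ n) :=
          le_mul_of_one_le_left (by positivity) (one_le_pow₀ hn1)
        linarith
    _ = (C₃ + C₂ + C₁) * (((n : ℝ) ^ 2 * ((2 : ℝ) ^ (γ - κ)) ^ n) * (2 : ℝ) ^ (-γ * n)) := by
        rw [e3]; ring
    _ ≤ (C₃ + C₂ + C₁) * (Real.sqrt n * (2 : ℝ) ^ (-γ * n)) := by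
        have : 1 ≤ Real.sqrt n := Real.one_le_sqrt.2 hn1
        have := hdec.trans this
        gcongr

/-! ### Regularity of the drift -/

lemma abs_integral_sub_integral_le_of_ae_bound {ξ : ℝ → ℝ} {C : ℝ}
    (hm : AEStronglyMeasurable ξ (volume.restrict (Icc 0 1)))
    (hC : ∀ᵐ t ∂(volume.restrict (Icc (0 : ℝ) 1)), |ξ t| ≤ C) :
    IntegrableOn ξ (Icc 0 1) ∧ ∀ t ∈ Icc (0 : ℝ) 1, ∀ s ∈ Icc (0 : ℝ) 1,
      |(∫ u in (0 : ℝ)..s, ξ u) - ∫ u in (0 : ℝ)..t, ξ u| ≤ C * |s - t| := by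
  have hint : IntegrableOn ξ (Icc 0 1) := Integrable.of_bound hm C hC
  have hii : ∀ t ∈ Icc (0 : ℝ) 1, IntervalIntegrable ξ volume 0 t := fun t ht => by
    rw [intervalIntegrable_iff_integrableOn_Icc_of_le ht.1]
    exact hint.mono_set (Icc_subset_Icc_right ht.2)
  refine ⟨hint, fun t ht s hs => ?_⟩
  rw [intervalIntegral.integral_interval_sub_left (hii s hs) (hii t ht)]
  refine intervalIntegral.norm_integral_le_of_norm_le_const_ae (f := ξ) (a := t) (b := s) ?_
  have h := (ae_restrict_iff' measurableSet_Icc).1 hC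
  filter_upwards [h] with u hu hut
  refine hu (ordConnected_Icc.uIcc_subset ht hs ?_)
  exact uIoc_subset_uIcc hut

/-- Dyadic increment bounds for a Lipschitz path with affine approximations. -/
lemma dyadic_bounds_of_lipschitz {D A : ℝ → ℝ} {C c p β κ : ℝ} (hC : 0 ≤ C) (hc : 0 ≤ c)
    (hβ : β ≤ 1) (hp : 0 ≤ p) (hκ : κ ≤ p)
    (hD : ∀ t ∈ Icc (0 : ℝ) 1, ∀ s ∈ Icc (0 : ℝ) 1, |D s - D t| ≤ C * |s - t|)
    (hA : ∀ t ∈ Icc (0 : ℝ) 1, ∀ s ∈ Icc (0 : ℝ) 1,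
      |D s - D t - A t * (s - t)| ≤ c * |s - t| ^ p) (n k : ℕ) (hk : k < 2 ^ n) :
    (∀ s ∈ Icc ((k : ℝ) / 2 ^ n) ((k + 1 : ℝ) / 2 ^ n),
      |D s - D ((k : ℝ) / 2 ^ n)| ≤ C * ((2 : ℝ) ^ (-β)) ^ n) ∧
    ∃ A', ∀ s ∈ Icc ((k : ℝ) / 2 ^ n) ((k + 1 : ℝ) / 2 ^ n),
      |D s - D ((k : ℝ) / 2 ^ n) - A' * (s - (k : ℝ) / 2 ^ n)| ≤ c * ((2 : ℝ) ^ (-κ)) ^ n := by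
  have hk1 : (k : ℝ) + 1 ≤ 2 ^ n := by exact_mod_cast hk
  have hsub : Icc ((k : ℝ) / 2 ^ n) ((k + 1 : ℝ) / 2 ^ n) ⊆ Icc 0 1 :=
    Icc_subset_Icc (by positivity) ((div_le_one (by positivity)).2 hk1)
  have hk0 : (k : ℝ) / 2 ^ n ∈ Icc ((k : ℝ) / 2 ^ n) ((k + 1 : ℝ) / 2 ^ n) :=
    left_mem_Icc.2 (by gcongr; linarith)
  have hlen : ∀ s ∈ Icc ((k : ℝ) / 2 ^ n) ((k + 1 : ℝ) / 2 ^ n),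
      |s - (k : ℝ) / 2 ^ n| ≤ 1 / 2 ^ n := fun s hs => by
    rw [abs_of_nonneg (by linarith [hs.1])]
    have := hs.2
    rw [add_div] at this
    linarith
  have hpw : ∀ b p' : ℝ, b ≤ p' → ((1 : ℝ) / 2 ^ n) ^ p' ≤ ((2 : ℝ) ^ (-b)) ^ n := fun b p' hb => by
    rw [one_div, Real.inv_rpow (by positivity), ← Real.rpow_natCast, ← Real.rpow_natCast,
      ← Real.rpow_mul two_pos.le, ← Real.rpow_neg two_pos.le, ← Real.rpow_mul two_pos.le]
    refine Real.rpow_le_rpow_of_exponent_le one_le_two ?_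
    have := mul_le_mul_of_nonneg_left hb (Nat.cast_nonneg (α := ℝ) n)
    linarith
  refine ⟨fun s hs => (hD _ (hsub hk0) s (hsub hs)).trans ?_, A (k / 2 ^ n), fun s hs =>
    (hA _ (hsub hk0) s (hsub hs)).trans ?_⟩
  · have := hpw β 1 hβ
    rw [Real.rpow_one] at this
    exact mul_le_mul_of_nonneg_left ((hlen s hs).trans this) hC
  · refine mul_le_mul_of_nonneg_left (le_trans ?_ (hpw κ p hκ)) hc
    exact Real.rpow_le_rpow (abs_nonneg _) (hlen s hs) hp

/-- The regularity of the drift path `D` with exponents `β` and `κ`. -/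
def DriftRegular (D : ℝ → ℝ) (β κ : ℝ) : Prop :=
  ContinuousOn D (Icc 0 1) ∧
  (∃ C, ∀ n k : ℕ, k < 2 ^ n → ∀ s ∈ Icc ((k : ℝ) / 2 ^ n) ((k + 1 : ℝ) / 2 ^ n),
    |D s - D ((k : ℝ) / 2 ^ n)| ≤ C * ((2 : ℝ) ^ (-β)) ^ n) ∧
  ∃ C, ∀ n k : ℕ, k < 2 ^ n → ∃ A, ∀ s ∈ Icc ((k : ℝ) / 2 ^ n) ((k + 1 : ℝ) / 2 ^ n),
    |D s - D ((k : ℝ) / 2 ^ n) - A * (s - (k : ℝ) / 2 ^ n)| ≤ C * ((2 : ℝ) ^ (-κ)) ^ n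

lemma continuousOn_of_abs_sub_le_mul {D : ℝ → ℝ} {C : ℝ} {s : Set ℝ}
    (hD : ∀ t ∈ s, ∀ u ∈ s, |D u - D t| ≤ C * |u - t|) : ContinuousOn D s := by
  have : LipschitzOnWith C.toNNReal D s := by
    refine LipschitzOnWith.of_dist_le_mul fun x hx y hy => ?_
    rw [Real.dist_eq, Real.dist_eq]
    exact (hD y hy x hx).trans (by gcongr; exact Real.le_coe_toNNReal C)
  exact this.continuousOn

lemma driftRegular_of_ae_bound {ξ : ℝ → ℝ} {C β κ : ℝ} (hβ : β ≤ 1) (hκ : κ ≤ 1)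
    (hm : AEStronglyMeasurable ξ (volume.restrict (Icc 0 1)))
    (hC : ∀ᵐ t ∂(volume.restrict (Icc (0 : ℝ) 1)), |ξ t| ≤ C) :
    DriftRegular (fun t => ∫ u in (0 : ℝ)..t, ξ u) β κ := by
  obtain ⟨-, h⟩ := abs_integral_sub_integral_le_of_ae_bound hm hC
  have hC0 : 0 ≤ C := by
    have := (abs_nonneg _).trans (h 0 (by simp) 1 (by simp))
    simpa using this
  have key := dyadic_bounds_of_lipschitz (A := fun _ => 0) (p := 1) hC0 hC0 hβ zero_le_one hκ h
    (fun t ht s hs => by simpa using h t ht s hs)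
  exact ⟨continuousOn_of_abs_sub_le_mul h, ⟨C, fun n k hk => (key n k hk).1⟩,
    ⟨C, fun n k hk => (key n k hk).2⟩⟩

lemma driftRegular_of_holder {ξ : ℝ → ℝ} {a c β κ : ℝ} (hβ : β ≤ 1) (ha : 0 < a) (hc : 0 ≤ c)
    (hκ : κ ≤ 1 + a)
    (hξ : ∀ s ∈ Icc (0 : ℝ) 1, ∀ t ∈ Icc (0 : ℝ) 1, |ξ s - ξ t| ≤ c * |s - t| ^ a) :
    DriftRegular (fun t => ∫ u in (0 : ℝ)..t, ξ u) β κ := by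
  have hξc : ContinuousOn ξ (Icc 0 1) := by
    intro t ht
    rw [ContinuousWithinAt, tendsto_iff_dist_tendsto_zero]
    have hl : Tendsto (fun s : ℝ => c * |s - t| ^ a) (𝓝[Icc 0 1] t) (𝓝 0) := by
      have : Continuous fun s : ℝ => c * |s - t| ^ a :=
        continuous_const.mul ((continuous_id.sub continuous_const).abs.rpow_const
          fun _ => Or.inr ha.le)
      have h := (this.tendsto t).mono_left (nhdsWithin_le_nhds (s := Icc (0 : ℝ) 1))
      simpa [Real.zero_rpow ha.ne'] using h
    refine squeeze_zero' (.of_forall fun _ => dist_nonneg) ?_ hl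
    filter_upwards [self_mem_nhdsWithin] with s hs
    exact hξ s hs t ht
  obtain ⟨C, hC⟩ := isCompact_Icc.exists_bound_of_continuousOn hξc
  obtain ⟨hint, h⟩ := abs_integral_sub_integral_le_of_ae_bound
    (hξc.aestronglyMeasurable measurableSet_Icc) (C := C)
    ((ae_restrict_iff' measurableSet_Icc).2 (.of_forall hC))
  have hC0 : 0 ≤ C := (norm_nonneg _).trans (hC 0 (by simp))
  have hii : ∀ t ∈ Icc (0 : ℝ) 1, ∀ s ∈ Icc (0 : ℝ) 1, IntervalIntegrable ξ volume t s :=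
    fun t ht s hs => (hξc.mono (ordConnected_Icc.uIcc_subset ht hs)).intervalIntegrable
  have h0 : (0 : ℝ) ∈ Icc (0 : ℝ) 1 := by simp
  have key := dyadic_bounds_of_lipschitz (A := ξ) (c := c) (p := 1 + a) hC0 hc hβ (by linarith) hκ h
    (fun t ht s hs => by
      have e : (∫ u in (0 : ℝ)..s, ξ u) - (∫ u in (0 : ℝ)..t, ξ u) - ξ t * (s - t) =
          ∫ u in t..s, (ξ u - ξ t) := by
        rw [intervalIntegral.integral_sub (hii t ht s hs) intervalIntegrable_const,
          intervalIntegral.integral_interval_sub_left (hii 0 h0 s hs) (hii 0 h0 t ht)]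
        simp [mul_comm]
      rw [e]
      have := intervalIntegral.norm_integral_le_of_norm_le_const (a := t) (b := s)
        (f := fun u => ξ u - ξ t) (C := c * |s - t| ^ a) (fun u hu => by
          refine (hξ u (ordConnected_Icc.uIcc_subset ht hs (uIoc_subset_uIcc hu)) t ht).trans ?_
          have := abs_sub_left_of_mem_uIcc (uIoc_subset_uIcc hu)
          gcongr)
      refine this.trans (le_of_eq ?_)
      rcases eq_or_ne s t with rfl | hst
      · simp [Real.zero_rpow (by linarith : (1 + a) ≠ 0)]
      · rw [Real.rpow_add (abs_pos.2 (sub_ne_zero.2 hst)), Real.rpow_one]; ring)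
  exact ⟨continuousOn_of_abs_sub_le_mul h, ⟨C, fun n k hk => (key n k hk).1⟩,
    ⟨c, fun n k hk => (key n k hk).2⟩⟩

lemma aestronglyMeasurable_restrict_of_isStronglyProgressive {Ω : Type*} {mΩ : MeasurableSpace Ω}
    {𝓕 : Filtration ℝ mΩ} {ξ : ℝ → Ω → ℝ} (hξ : IsStronglyProgressive 𝓕 ξ) (ω : Ω) :
    AEStronglyMeasurable (fun t => ξ t ω) (volume.restrict (Icc (0 : ℝ) 1)) := by
  have h1 : Measurable[Subtype.instMeasurableSpace.prod (𝓕 1)]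
      fun p : Set.Iic (1 : ℝ) × Ω => ξ p.1 p.2 := (hξ 1).measurable
  have h2 : Measurable fun t : Set.Iic (1 : ℝ) => ξ t ω :=
    @Measurable.comp _ _ _ _ (Subtype.instMeasurableSpace.prod (𝓕 1)) _ _ _ h1
      (@measurable_prodMk_right _ _ _ (𝓕 1) ω)
  exact ((aemeasurable_restrict_of_measurable_subtype measurableSet_Iic h2).mono_measure
    (Measure.restrict_mono Icc_subset_Iic_self le_rfl)).aestronglyMeasurable

/-- Admissible exponents: `κ` is the convergence rate, `β` the Hölder exponent of the paths and
`θ` the relative depth of the block decomposition. -/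
lemma exists_rate_exponents {H : ℝ} (hH : H ∈ Ioo (0 : ℝ) 1) (hH' : H ≠ 1 / 2) :
    ∃ κ β θ : ℝ, 0 < κ ∧ min (H / 2) (1 / 4) < κ ∧ κ ≤ β ∧ H + κ ≤ 2 * β ∧ 0 < β ∧ β < H ∧
      0 ≤ θ ∧ θ ≤ 1 ∧ κ ≤ β * θ ∧ 2 * κ < 1 - θ ∧ κ ≤ H := by
  obtain ⟨h0, h1⟩ := hH
  have hd : 0 < 2 * H + 1 := by linarith
  have hlt : min (H / 2) (1 / 4) < H / (2 * H + 1) := by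
    rcases lt_or_gt_of_ne hH' with h | h
    · refine (min_le_left _ _).trans_lt ?_
      rw [lt_div_iff₀ hd]; nlinarith
    · refine (min_le_right _ _).trans_lt ?_
      rw [lt_div_iff₀ hd]; linarith
  obtain ⟨κ, hκ1, hκ2⟩ := exists_between hlt
  have hκ0 : 0 < κ := lt_of_le_of_lt (le_min (by linarith) (by norm_num)) hκ1
  have hκ3 : κ * (2 * H + 1) < H := (lt_div_iff₀ hd).1 hκ2
  have hκH : κ < H := by nlinarith
  have hmax : max (κ * (2 * H + 1)) ((H + κ) / 2) < H := max_lt hκ3 (by linarith)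
  obtain ⟨β, hβ1, hβ2⟩ := exists_between hmax
  have hβ3 := (le_max_left _ _).trans hβ1.le
  have hβ4 := (le_max_right _ _).trans hβ1.le
  have hκβ : κ ≤ β := by nlinarith
  refine ⟨κ, β, 1 / (2 * H + 1), hκ0, hκ1, hκβ, by linarith, by linarith, hβ2, by positivity, ?_,
    ?_, ?_, hκH.le⟩
  · rw [div_le_one hd]; linarith
  · rw [mul_one_div, le_div_iff₀ hd]; exact hβ3
  · have : 1 - 1 / (2 * H + 1) = 2 * (H / (2 * H + 1)) := by field_simp; ring
    rw [this]; linarith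

end

/-- Theorem 1.2: almost sure rate of convergence `O(√n · 2^{-(H/2 ∧ 1/4)n})` of the
sequential scale estimator applied to `Y_t = ∫₀ᵗ g(X_s) ds`, where
`X_t = x₀ + W^H_t + ∫₀ᵗ ξ_s ds` is a drifted fractional Brownian motion.
The sequential scale estimate `𝓡^s_n(Y)(ω)` is `Rhat n (ηs n ω • Y(ω))`, where
`ηs n ω` is the (pathwise) sequential scaling factor, i.e. the positive minimizer of
`η ↦ Σ_{k=n-m}^n α_{n-k} (𝓡̂_k(ηY) - 𝓡̂_{k-1}(ηY))²`. -/
theorem stmt0 {Ω : Type*} [MeasurableSpace Ω] (P : Measure Ω) [IsProbabilityMeasure P]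
    (H : ℝ) (hH : H ∈ Set.Ioo (0 : ℝ) 1) (hH' : H ≠ 1 / 2)
    (W : ℝ → Ω → ℝ) (hW : IsFBM P H W)
    (hWsm : ∀ t, StronglyMeasurable (W t))
    (x₀ : ℝ) (ξ : ℝ → Ω → ℝ)
    (hξ : ProgMeasurable (MeasureTheory.Filtration.natural W hWsm) ξ)
    (hdrift₁ : H < 1 / 2 → ∃ C : Ω → ℝ, ∀ᵐ ω ∂P,
      ∀ᵐ t ∂(volume.restrict (Set.Icc (0 : ℝ) 1)), |ξ t ω| ≤ C ω)
    (hdrift₂ : 1 / 2 < H → ∀ᵐ ω ∂P, ∃ a c : ℝ, 2 * H - 1 < a ∧ 0 ≤ c ∧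
      ∀ s ∈ Set.Icc (0 : ℝ) 1, ∀ t ∈ Set.Icc (0 : ℝ) 1,
        |ξ s ω - ξ t ω| ≤ c * |s - t| ^ a)
    (X : ℝ → Ω → ℝ)
    (hX : ∀ ω, ∀ t ∈ Set.Icc (0 : ℝ) 1,
      X t ω = x₀ + W t ω + ∫ s in (0 : ℝ)..t, ξ s ω)
    (g : ℝ → ℝ) (hg : ContDiff ℝ 2 g)
    (hpos : ∀ᵐ ω ∂P, 0 < ∫ s in (0 : ℝ)..1, (deriv g (X s ω)) ^ 2)
    (m : ℕ) (a : ℕ → ℝ) (ha0 : 0 < a 0) (ha : ∀ j ≤ m, 0 ≤ a j)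
    (ηs : ℕ → Ω → ℝ)
    -- `ηs n ω` is the sequential scaling factor for the path `t ↦ ∫₀ᵗ g(X_s(ω)) ds`
    (hηs : ∀ᵐ ω ∂P, ∀ n, m < n → 0 < ηs n ω ∧ ∀ η : ℝ, 0 < η →
      (∑ k ∈ Finset.Icc (n - m) n, a (n - k) *
        (Rhat k (fun t => ηs n ω * ∫ s in (0 : ℝ)..t, g (X s ω)) -
          Rhat (k - 1) (fun t => ηs n ω * ∫ s in (0 : ℝ)..t, g (X s ω))) ^ 2) ≤
      (∑ k ∈ Finset.Icc (n - m) n, a (n - k) *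
        (Rhat k (fun t => η * ∫ s in (0 : ℝ)..t, g (X s ω)) -
          Rhat (k - 1) (fun t => η * ∫ s in (0 : ℝ)..t, g (X s ω))) ^ 2)) :
    ∀ᵐ ω ∂P, ∃ C : ℝ, ∀ᶠ n : ℕ in atTop,
      |Rhat n (fun t => ηs n ω * ∫ s in (0 : ℝ)..t, g (X s ω)) - H| ≤
        C * (Real.sqrt n * (2 : ℝ) ^ (-(min (H / 2) (1 / 4)) * n)) := by
  obtain ⟨κ, β, θ, hκ0, hγκ, hκβ, hHκ, hβ0, hβH, hθ0, hθ1, hκθ, hκ2, hκH⟩ :=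
    exists_rate_exponents hH hH'
  have hβ1 : β ≤ 1 := hβH.le.trans hH.2.le
  have hl : ∀ n : ℕ, ⌊θ * n⌋₊ ≤ n := fun n =>
    Nat.floor_le_of_le (mul_le_of_le_one_left (Nat.cast_nonneg n) hθ1)
  have hlθ : ∀ n : ℕ, (⌊θ * n⌋₊ : ℝ) ≤ θ * n := fun n => Nat.floor_le (by positivity)
  have hlβ : ∀ n : ℕ, κ * n ≤ β * ((⌊θ * n⌋₊ : ℝ) + 1) := fun n =>
    calc κ * n ≤ β * θ * n := by gcongr
      _ = β * (θ * n) := mul_assoc _ _ _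
      _ ≤ _ := by gcongr; exact (Nat.lt_floor_add_one _).le
  have hdrift : ∀ᵐ ω ∂P, DriftRegular (fun t => ∫ s in (0 : ℝ)..t, ξ s ω) β (H + κ) := by
    rcases lt_or_gt_of_ne hH' with h | h
    · obtain ⟨C, hC⟩ := hdrift₁ h
      filter_upwards [hC] with ω hω
      exact driftRegular_of_ae_bound hβ1 (by linarith)
        (aestronglyMeasurable_restrict_of_isStronglyProgressive hξ ω) hω
    · filter_upwards [hdrift₂ h] with ω ⟨b, c, hb, hc, hω⟩
      exact driftRegular_of_holder hβ1 (by linarith) hc (by linarith) hω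
  filter_upwards [hW.ae_exists_abs_sub_le hH.1 hβ0 hβH,
    hW.ae_exists_sum_block_le hH hl hlθ hκ2, hW.2.1, hdrift, hpos, hηs] with ω hC₁ hC₄ hWc hD hV hη
  obtain ⟨C₁, -, hC₁⟩ := hC₁
  obtain ⟨C₄, -, hC₄⟩ := hC₄
  obtain ⟨hDc, ⟨C₂, hC₂⟩, C₃, hC₃⟩ := hD
  obtain ⟨V, hVpos, C, -, hC⟩ := exists_abs_sum_vartheta_sq_sub_le (x := fun t => X t ω) hH hκ0 hκβ
    hHκ hl hlβ hg hWc hDc (hX ω) hC₁ hC₂ hC₃ hC₄ hV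
  exact exists_abs_Rhat_sequential_sub_le hκ0 hγκ hVpos hC ha0 ha hη
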